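/- Let Γ be the free group on generators γ₁,…,γ_r (r ≥ 1). For 1 ≤ i ≤ r let ℓ_i and ℓ'_i be geodesic lines of ℍ with transverse orientations given by connected components U_i of ℍ∖ℓ_i and U'_i of ℍ∖ℓ'_i, and suppose the 2r closed half-planes ℓ₁∪U₁, ℓ'₁∪U'₁, …, ℓ_r∪U_r, ℓ'_r∪U'_r have pairwise disjoint closures in the one-point compactification of ℂ. Let j : Γ → PSL(2,ℝ) be a homomorphism satisfying j(γ_i)·(ℓ_i ∪ U_i) = ℍ ∖ U'_i for all i. Suppose g_i, g'_i ∈ PSL(2,ℝ) are such that the 2r closed right crooked half-spaces g_i·H̄*₊(ℓ_i, U_i) and g'_i·H̄*₊(ℓ'_i, U'_i) (1 ≤ i ≤ r) are pairwise disjoint, and let ρ : Γ → PSL(2,ℝ) be the homomorphism determined by ρ(γ_i) = g'_i j(γ_i) g_i⁻¹ for all i. Then: (1) there exists c < 1 with λ(ρ(γ)) ≤ c·λ(j(γ)) for all γ ∈ Γ; (2) the action γ·x = ρ(γ) x j(γ)⁻¹ of Γ on PSL(2,ℝ) is properly discontinuous; (3) the set R = PSL(2,ℝ) ∖ ⋃_{i=1}^r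 ( g_i·H*₊(ℓ_i,U_i) ∪ g'_i·H*₊(ℓ'_i,U'_i) ) is a fundamental domain for this action. -/

import Mathlib

noncomputable section

open Filter Topology Pointwise
open scoped UpperHalfPlane

/-- `SL(2,ℝ)`. -/
abbrev SL2 := Matrix.SpecialLinearGroup (Fin 2) ℝ

instance : TopologicalSpace SL2 :=
  TopologicalSpace.induced (fun A : SL2 => (A : Matrix (Fin 2) (Fin 2) ℝ)) inferInstance

/-- `PSL(2,ℝ) = SL(2,ℝ)/{±I}`. -/
abbrev PSL2 := SL2 ⧸ Subgroup.center SL2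

/-- The Möbius action of an element of `PSL(2,ℝ)` on the upper half-plane,
computed via an (arbitrary) lift to `SL(2,ℝ)`; this is well defined since
`-I` acts trivially. -/
def pslSMul (g : PSL2) (z : ℍ) : ℍ := (Quotient.out g) • z

/-- Image of a subset of `ℍ` under the Möbius action of `g ∈ PSL(2,ℝ)`. -/
def pslImg (g : PSL2) (s : Set ℍ) : Set ℍ := pslSMul g '' s

/-- A geodesic line of `ℍ`: the image of an isometric embedding of `ℝ` into `ℍ`. -/
def IsGeodesicLine (l : Set ℍ) : Prop := ∃ γ : ℝ → ℍ, Isometry γ ∧ Set.range γ = l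

/-- The embedding of `ℍ` into the one-point compactification of `ℂ`. -/
def embH (z : ℍ) : OnePoint ℂ := ((z : ℂ) : OnePoint ℂ)

/-- The embedding of `∂∞ℍ = ℝ ∪ {∞}` into the one-point compactification of `ℂ`. -/
def toC : OnePoint ℝ → OnePoint ℂ := OnePoint.map Complex.ofReal

/-- The vector `v(ξ) ∈ ℝ²` associated with a boundary point `ξ ∈ ℝ ∪ {∞}`:
`v(ξ) = (ξ, 1)` for `ξ ∈ ℝ` and `v(∞) = (1, 0)`. -/
def bvec (ξ : OnePoint ℝ) : Fin 2 → ℝ := Option.elim ξ ![1, 0] (fun r => ![r, 1])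

/-- The extended Möbius action of `PSL(2,ℝ)` on `∂∞ℍ = ℝ ∪ {∞}`. -/
def bdSMul (g : PSL2) (ξ : OnePoint ℝ) : OnePoint ℝ :=
  let w := ((Quotient.out g : SL2) : Matrix (Fin 2) (Fin 2) ℝ).mulVec (bvec ξ)
  if w 1 = 0 then OnePoint.infty else ((w 0 / w 1 : ℝ) : OnePoint ℝ)

/-- `ξ ∈ ℝ ∪ {∞}` is an endpoint of the geodesic line `l`: some isometric
parametrization of `l` tends to `ξ` (in the one-point compactification of `ℂ`). -/
def IsEndpoint (l : Set ℍ) (ξ : OnePoint ℝ) : Prop :=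
  ∃ γ : ℝ → ℍ, Isometry γ ∧ Set.range γ = l ∧
    Tendsto (fun t => embH (γ t)) atTop (𝓝 (toC ξ))

/-- `h ∈ PSL(2,ℝ)` has a nonattracting fixed point at `ξ ∈ ℝ ∪ {∞}`. -/
def HasNonattracting (h : PSL2) (ξ : OnePoint ℝ) : Prop :=
  ∃ A : SL2, (QuotientGroup.mk A : PSL2) = h ∧
    ∃ μ : ℝ, |μ| ≤ 1 ∧ (A : Matrix (Fin 2) (Fin 2) ℝ).mulVec (bvec ξ) = μ • bvec ξ

/-- `h ∈ PSL(2,ℝ)` has a nonrepelling fixed point at `ξ ∈ ℝ ∪ {∞}`. -/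
def HasNonrepelling (h : PSL2) (ξ : OnePoint ℝ) : Prop :=
  ∃ A : SL2, (QuotientGroup.mk A : PSL2) = h ∧
    ∃ μ : ℝ, 1 ≤ |μ| ∧ (A : Matrix (Fin 2) (Fin 2) ℝ).mulVec (bvec ξ) = μ • bvec ξ

/-- The right AdS crooked plane `C*(l)` centered at the identity. -/
def rightCrooked (l : Set ℍ) : Set PSL2 :=
  {h | (∃ x ∈ l, pslSMul h x = x) ∨ ∃ ξ, IsEndpoint l ξ ∧ HasNonattracting h ξ}

/-- The left AdS crooked plane `C(l)` centered at the identity. -/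
def leftCrooked (l : Set ℍ) : Set PSL2 :=
  {h | (∃ x ∈ l, pslSMul h x = x) ∨ ∃ ξ, IsEndpoint l ξ ∧ HasNonrepelling h ξ}

/-- A general right AdS crooked plane: a set of the form `g·C*(l)`. -/
def IsRightCrookedPlane (S : Set PSL2) : Prop :=
  ∃ (g : PSL2) (l : Set ℍ), IsGeodesicLine l ∧ S = (g * ·) '' rightCrooked l

/-- A general left AdS crooked plane: a set of the form `C(l)·g`. -/
def IsLeftCrookedPlane (S : Set PSL2) : Prop :=
  ∃ (g : PSL2) (l : Set ℍ), IsGeodesicLine l ∧ S = (· * g) '' leftCrooked l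

variable {Γ : Type*} [Group Γ]

/-- The action `γ·x = ρ(γ) x j(γ)⁻¹` of `Γ` on `PSL(2,ℝ)`, applied to a set. -/
def actImg (j ρ : Γ →* PSL2) (γ : Γ) (S : Set PSL2) : Set PSL2 :=
  (fun x => ρ γ * x * (j γ)⁻¹) '' S

/-- The action `γ·x = ρ(γ) x j(γ)⁻¹` is properly discontinuous. -/
def ProperlyDisc (j ρ : Γ →* PSL2) : Prop :=
  ∀ K : Set PSL2, IsCompact K → {γ : Γ | (actImg j ρ γ K ∩ K).Nonempty}.Finite

/-- `R` is a fundamental domain for the action `γ·x = ρ(γ) x j(γ)⁻¹`: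
`R` is closed, its translates cover `PSL(2,ℝ)`, and the interiors of the
translates are pairwise disjoint. -/
def IsFundDom (j ρ : Γ →* PSL2) (R : Set PSL2) : Prop :=
  IsClosed R ∧ (⋃ γ : Γ, actImg j ρ γ R) = Set.univ ∧
    Pairwise fun γ₁ γ₂ : Γ =>
      Disjoint (interior (actImg j ρ γ₁ R)) (interior (actImg j ρ γ₂ R))

/-- The action admits a fundamental domain bounded by pairwise disjoint
right AdS crooked planes. -/
def AdmitsRightCrookedFD (j ρ : Γ →* PSL2) : Prop :=
  ∃ (m : ℕ) (D : Fin m → Set PSL2), (∀ i, IsRightCrookedPlane (D i)) ∧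
    (∀ (γ γ' : Γ) (i i' : Fin m),
      actImg j ρ γ (D i) = actImg j ρ γ' (D i') ∨
      Disjoint (actImg j ρ γ (D i)) (actImg j ρ γ' (D i'))) ∧
    ∃ x ∈ (⋃ (γ : Γ) (i : Fin m), actImg j ρ γ (D i))ᶜ,
      IsFundDom j ρ
        (closure (connectedComponentIn (⋃ (γ : Γ) (i : Fin m), actImg j ρ γ (D i))ᶜ x))

/-- The action admits a fundamental domain bounded by pairwise disjoint
left AdS crooked planes. -/
def AdmitsLeftCrookedFD (j ρ : Γ →* PSL2) : Prop :=
  ∃ (m : ℕ) (D : Fin m → Set PSL2), (∀ i, IsLeftCrookedPlane (D i)) ∧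
    (∀ (γ γ' : Γ) (i i' : Fin m),
      actImg j ρ γ (D i) = actImg j ρ γ' (D i') ∨
      Disjoint (actImg j ρ γ (D i)) (actImg j ρ γ' (D i'))) ∧
    ∃ x ∈ (⋃ (γ : Γ) (i : Fin m), actImg j ρ γ (D i))ᶜ,
      IsFundDom j ρ
        (closure (connectedComponentIn (⋃ (γ : Γ) (i : Fin m), actImg j ρ γ (D i))ᶜ x))

/-- The translation length `λ(g) = inf_{p ∈ ℍ} d(p, g·p)`. -/
def transLength (g : PSL2) : ℝ := ⨅ p : ℍ, dist p (pslSMul g p)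

/-- `U` is a connected component of `S`. -/
def IsCC (S U : Set ℍ) : Prop := ∃ x ∈ S, connectedComponentIn S x = U

/-- `ξ ∈ ℝ ∪ {∞}` is an ideal point of `U ⊆ ℍ`: a limit of a sequence of points
of `U` in the one-point compactification of `ℂ`. -/
def IsIdealPoint (U : Set ℍ) (ξ : OnePoint ℝ) : Prop :=
  ∃ u : ℕ → ℍ, (∀ n, u n ∈ U) ∧ Tendsto (fun n => embH (u n)) atTop (𝓝 (toC ξ))

/-- The closed right crooked half-space `H̄*₊(l, U)`. -/
def closedRHS (l U : Set ℍ) : Set PSL2 :=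
  {h | (∃ x ∈ l ∪ U, pslSMul h x = x) ∨ ∃ ξ, IsIdealPoint U ξ ∧ HasNonattracting h ξ}

/-- The open right crooked half-space `H*₊(l, U)`. -/
def openRHS (l U : Set ℍ) : Set PSL2 :=
  {h | h ≠ 1 ∧ ((∃ x ∈ U, pslSMul h x = x) ∨
    ∃ ξ, IsIdealPoint U ξ ∧ ¬ IsEndpoint l ξ ∧ HasNonattracting h ξ)}

/-- The circle of (Euclidean) radius `c` in `ℍ` centered at `0`; for suitable `c`
this is a geodesic line of `ℍ`. -/
def circ (c : ℝ) : Set ℍ := {z : ℍ | ‖(z : ℂ)‖ = c}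

/-- The stem quadrant `SQ(ℓ)` for `ℓ = {|z| = 1/R}` transversely oriented towards `0`. -/
def SQell (R : ℝ) : Set PSL2 :=
  {h | ∃ (A : SL2) (α β v : ℝ), (QuotientGroup.mk A : PSL2) = h ∧
    (A : Matrix (Fin 2) (Fin 2) ℝ) = !![α, -v/R; v*R, β] ∧
    |α| < |β| ∧ 2*|v| < |α - β|}

/-- The inverse stem quadrant `SQ(ℓ')⁻¹` for `ℓ' = {|z| = R}` transversely
oriented towards `∞`. -/
def SQell'inv (R : ℝ) : Set PSL2 :=
  {h | ∃ (A : SL2) (α β v : ℝ), (QuotientGroup.mk A : PSL2) = h ∧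
    (A : Matrix (Fin 2) (Fin 2) ℝ) = !![α, v*R; -v/R, β] ∧
    |α| < |β| ∧ 2*|v| < |α - β|}

/-- The stem quadrant `SQ(ℓ')`. -/
def SQell' (R : ℝ) : Set PSL2 := {h | h⁻¹ ∈ SQell'inv R}


/-! ### Symmetric matrices as triples -/

/-- Symmetric matrices `[[p,q],[q,r]]` as triples. -/
abbrev Tri := ℝ × ℝ × ℝ

/-- Polarized determinant. -/
def Bf (P Q : Tri) : ℝ := P.1 * Q.2.2 + P.2.2 * Q.1 - 2 * P.2.1 * Q.2.1

/-- `A P Aᵀ`. -/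
def act (A : SL2) (P : Tri) : Tri :=
  (A 0 0 ^ 2 * P.1 + 2 * A 0 0 * A 0 1 * P.2.1 + A 0 1 ^ 2 * P.2.2,
   A 0 0 * A 1 0 * P.1 + (A 0 0 * A 1 1 + A 0 1 * A 1 0) * P.2.1 + A 0 1 * A 1 1 * P.2.2,
   A 1 0 ^ 2 * P.1 + 2 * A 1 0 * A 1 1 * P.2.1 + A 1 1 ^ 2 * P.2.2)

/-- The symmetric matrix of a point of the upper half plane. -/
def Pz (z : ℍ) : Tri := ((z.re ^ 2 + z.im ^ 2) / z.im, z.re / z.im, 1 / z.im)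

/-- The rank one matrix `v vᵀ`. -/
def vv (v : Fin 2 → ℝ) : Tri := (v 0 ^ 2, v 0 * v 1, v 1 ^ 2)

/-- The closed cone of positive semidefinite matrices. -/
def Cone (P : Tri) : Prop := 0 ≤ P.1 ∧ 0 ≤ P.2.2 ∧ P.2.1 ^ 2 ≤ P.1 * P.2.2

theorem sl_det (A : SL2) : A 0 0 * A 1 1 - A 0 1 * A 1 0 = 1 := by
  have := A.det_coe
  rwa [Matrix.det_fin_two] at this

theorem tri_ext {P Q : Tri} (h1 : P.1 = Q.1) (h2 : P.2.1 = Q.2.1) (h3 : P.2.2 = Q.2.2) : P = Q :=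
  Prod.ext h1 (Prod.ext h2 h3)

theorem Bf_act (A : SL2) (P Q : Tri) : Bf (act A P) (act A Q) = Bf P Q := by
  have h := sl_det A
  have : Bf (act A P) (act A Q) = (A 0 0 * A 1 1 - A 0 1 * A 1 0) ^ 2 * Bf P Q := by
    simp only [Bf, act]; ring
  rw [this, h]; ring

theorem Bf_comm (P Q : Tri) : Bf P Q = Bf Q P := by simp only [Bf]; ring

theorem Bf_add (P Q R : Tri) : Bf P (Q + R) = Bf P Q + Bf P R := by
  simp only [Bf, Prod.fst_add, Prod.snd_add]; ring

theorem Bf_smul (c : ℝ) (P Q : Tri) : Bf P (c • Q) = c * Bf P Q := by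
  simp only [Bf, Prod.smul_fst, Prod.smul_snd, smul_eq_mul]; ring

theorem Bf_add' (P Q R : Tri) : Bf (P + Q) R = Bf P R + Bf Q R := by
  simp only [Bf, Prod.fst_add, Prod.snd_add]; ring

theorem Bf_smul' (c : ℝ) (P Q : Tri) : Bf (c • P) Q = c * Bf P Q := by
  simp only [Bf, Prod.smul_fst, Prod.smul_snd, smul_eq_mul]; ring

theorem act_add (A : SL2) (P Q : Tri) : act A (P + Q) = act A P + act A Q := by
  apply tri_ext <;> simp only [act, Prod.fst_add, Prod.snd_add] <;> ring

theorem act_smul (A : SL2) (c : ℝ) (P : Tri) : act A (c • P) = c • act A P := by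
  apply tri_ext <;> simp only [act, Prod.smul_fst, Prod.smul_snd, smul_eq_mul] <;> ring

theorem mul00 (A B : SL2) : (A * B) 0 0 = A 0 0 * B 0 0 + A 0 1 * B 1 0 := by
  simp [Matrix.mul_apply, Fin.sum_univ_two]
theorem mul01 (A B : SL2) : (A * B) 0 1 = A 0 0 * B 0 1 + A 0 1 * B 1 1 := by
  simp [Matrix.mul_apply, Fin.sum_univ_two]
theorem mul10 (A B : SL2) : (A * B) 1 0 = A 1 0 * B 0 0 + A 1 1 * B 1 0 := by
  simp [Matrix.mul_apply, Fin.sum_univ_two]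
theorem mul11 (A B : SL2) : (A * B) 1 1 = A 1 0 * B 0 1 + A 1 1 * B 1 1 := by
  simp [Matrix.mul_apply, Fin.sum_univ_two]

theorem inv00 (A : SL2) : A⁻¹ 0 0 = A 1 1 := by
  simp [Matrix.SpecialLinearGroup.SL2_inv_expl]
theorem inv01 (A : SL2) : A⁻¹ 0 1 = - A 0 1 := by
  simp [Matrix.SpecialLinearGroup.SL2_inv_expl]
theorem inv10 (A : SL2) : A⁻¹ 1 0 = - A 1 0 := by
  simp [Matrix.SpecialLinearGroup.SL2_inv_expl]
theorem inv11 (A : SL2) : A⁻¹ 1 1 = A 0 0 := by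
  simp [Matrix.SpecialLinearGroup.SL2_inv_expl]

theorem act_mul (A B : SL2) (P : Tri) : act (A * B) P = act A (act B P) := by
  apply tri_ext <;> simp only [act, mul00, mul01, mul10, mul11] <;> ring

theorem act_one (P : Tri) : act 1 P = P := by
  apply tri_ext <;> simp [act]

theorem act_neg (A : SL2) (P : Tri) : act (-A) P = act A P := by
  apply tri_ext <;> simp [act]

theorem act_inv_act (A : SL2) (P : Tri) : act A⁻¹ (act A P) = P := by
  rw [← act_mul, inv_mul_cancel, act_one]

theorem act_act_inv (A : SL2) (P : Tri) : act A (act A⁻¹ P) = P := by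
  rw [← act_mul, mul_inv_cancel, act_one]

theorem act_vv (A : SL2) (v : Fin 2 → ℝ) :
    act A (vv v) = vv ((A : Matrix (Fin 2) (Fin 2) ℝ).mulVec v) := by
  apply tri_ext <;> simp [act, vv, Matrix.mulVec, dotProduct, Fin.sum_univ_two] <;> ring

theorem Pz_act (A : SL2) (z : ℍ) : Pz (A • z) = act A (Pz z) := by
  have hy := z.im_pos
  have hd := sl_det A
  set a := A 0 0 with ha
  set b := A 0 1 with hb
  set c := A 1 0 with hc
  set d := A 1 1 with hd'
  set x := z.re with hx
  set y := z.im with hy'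
  have hcoe : ((A • z : ℍ) : ℂ) = ((a : ℂ) * z + b) / ((c : ℂ) * z + d) := by
    rw [UpperHalfPlane.coe_specialLinearGroup_apply]
    simp [ha, hb, hc, hd']
  have hN : 0 < (c * x + d) ^ 2 + (c * y) ^ 2 := by
    by_cases hc0 : c = 0
    · have : d ≠ 0 := by rintro h; rw [hc0, h] at hd; simp at hd
      have h2 : 0 < d ^ 2 := by positivity
      rw [hc0]; simpa using h2
    · have : 0 < (c * y) ^ 2 := by positivity
      positivity
  have hns : Complex.normSq ((c : ℂ) * z + d) = (c * x + d) ^ 2 + (c * y) ^ 2 := by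
    simp [Complex.normSq_apply, hx, hy']; ring
  have hre : (A • z).re = ((a * x + b) * (c * x + d) + a * c * y ^ 2) /
      ((c * x + d) ^ 2 + (c * y) ^ 2) := by
    rw [← UpperHalfPlane.coe_re, hcoe, Complex.div_re, hns, ← add_div]
    congr 1
    simp [hx, hy']; ring
  have him : (A • z).im = y / ((c * x + d) ^ 2 + (c * y) ^ 2) := by
    rw [← UpperHalfPlane.coe_im, hcoe, Complex.div_im, hns, ← sub_div]
    congr 1
    have : y = y * (a * d - b * c) := by rw [hd]; ring
    rw [this]
    simp [hy']; ring
  have hyn : y ≠ 0 := hy.ne'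
  have hNn := hN.ne'
  obtain ⟨N, hNd⟩ : ∃ N, N = (c * x + d) ^ 2 + (c * y) ^ 2 := ⟨_, rfl⟩
  rw [← hNd] at hre him hNn
  apply tri_ext
  · simp only [Pz, act, hre, him]
    rw [← ha, ← hb, ← hx, ← hy']
    field_simp
    have : ((a * x + b) * (c * x + d) + a * c * y ^ 2) ^ 2 + y ^ 2 * (a * d - b * c) ^ 2
      = ((c * x + d) ^ 2 + (c * y) ^ 2) * (a ^ 2 * (x ^ 2 + y ^ 2) + 2 * a * b * x + b ^ 2) := by ring
    rw [hd, ← hNd] at this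
    linear_combination this
  · simp only [Pz, act, hre, him]
    rw [← ha, ← hb, ← hc, ← hd', ← hx, ← hy']
    field_simp
    ring
  · simp only [Pz, act, him]
    rw [← hc, ← hd', ← hx, ← hy']
    field_simp
    rw [hNd]; ring

theorem cosh_Bf (z w : ℍ) : 2 * Real.cosh (dist z w) = Bf (Pz z) (Pz w) := by
  rw [UpperHalfPlane.cosh_dist, Complex.dist_eq, ← Complex.normSq_eq_norm_sq, Complex.normSq_apply]
  have h1 := z.im_pos.ne'
  have h2 := w.im_pos.ne'
  simp only [Complex.sub_re, Complex.sub_im, UpperHalfPlane.coe_re, UpperHalfPlane.coe_im, Bf, Pz]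
  field_simp
  ring

theorem Pz_pos (z : ℍ) : 0 < (Pz z).1 ∧ 0 < (Pz z).2.2 ∧ (Pz z).1 * (Pz z).2.2 - (Pz z).2.1 ^ 2 = 1 := by
  have h1 := z.im_pos
  refine ⟨by simp only [Pz]; positivity, by simp only [Pz]; positivity, ?_⟩
  simp only [Pz]; field_simp; ring

theorem Pz_cone (z : ℍ) : Cone (Pz z) := by
  obtain ⟨h1, h2, h3⟩ := Pz_pos z
  exact ⟨h1.le, h2.le, by linarith⟩

theorem Pz_inj {z w : ℍ} (h : Pz z = Pz w) : z = w := by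
  have h1 := z.im_pos
  have h2 := w.im_pos
  simp only [Pz, Prod.mk.injEq] at h
  obtain ⟨-, hb, hc⟩ := h
  have him : z.im = w.im := by
    field_simp at hc; exact hc.symm
  rw [him] at hb
  have hre : z.re = w.re := by field_simp at hb; exact hb
  exact UpperHalfPlane.ext_re_im hre him

theorem exists_Pz {P : Tri} (hp : 0 < P.1) (hd : 0 < P.1 * P.2.2 - P.2.1 ^ 2) :
    ∃ z : ℍ, ∃ c : ℝ, 0 < c ∧ P = c • Pz z := by
  obtain ⟨p, q, r⟩ := P
  simp only at hp hd
  have hr : 0 < r := by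
    by_contra h
    push Not at h
    nlinarith [sq_nonneg q, mul_nonneg hp.le (neg_nonneg.2 h)]
  set D := Real.sqrt (p * r - q ^ 2) with hD
  have hDp : 0 < D := Real.sqrt_pos.2 hd
  have hD2 : D ^ 2 = p * r - q ^ 2 := Real.sq_sqrt hd.le
  refine ⟨UpperHalfPlane.mk ⟨q / r, D / r⟩ (by simp; positivity), D, hDp, ?_⟩
  apply tri_ext
  · simp [Pz]
    field_simp
    rw [hD2]; ring
  · simp [Pz]
    field_simp
  · simp [Pz]
    field_simp

theorem cone_rank_one {P : Tri} (h : Cone P) (hd : P.1 * P.2.2 - P.2.1 ^ 2 = 0) :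
    ∃ v : Fin 2 → ℝ, P = vv v := by
  obtain ⟨p, q, r⟩ := P
  obtain ⟨hp, hr, -⟩ := h
  simp only at hp hr hd
  have hq : q ^ 2 = p * r := by linarith
  have hq' : |q| = Real.sqrt p * Real.sqrt r := by
    rw [← Real.sqrt_sq_eq_abs, hq, Real.sqrt_mul hp]
  rcases le_total 0 q with h0 | h0
  · refine ⟨![Real.sqrt p, Real.sqrt r], ?_⟩
    rw [abs_of_nonneg h0] at hq'
    apply tri_ext <;> simp [vv, Real.sq_sqrt, hp, hr, hq']
  · refine ⟨![Real.sqrt p, -Real.sqrt r], ?_⟩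
    rw [abs_of_nonpos h0] at hq'
    apply tri_ext <;> simp [vv, Real.sq_sqrt, hp, hr, ← hq']

theorem Bf_vv (u v : Fin 2 → ℝ) : Bf (vv u) (vv v) = (u 0 * v 1 - u 1 * v 0) ^ 2 := by
  simp only [Bf, vv]; ring

theorem vv_cone (v : Fin 2 → ℝ) : Cone (vv v) :=
  ⟨by simp only [vv]; positivity, by simp only [vv]; positivity, by simp only [vv]; apply le_of_eq; ring⟩

theorem Cone.nonneg_Bf {P Q : Tri} (hP : Cone P) (hQ : Cone Q) : 0 ≤ Bf P Q := by
  obtain ⟨p, q, r⟩ := P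
  obtain ⟨p', q', r'⟩ := Q
  obtain ⟨h1, h2, h3⟩ := hP
  obtain ⟨k1, k2, k3⟩ := hQ
  simp only [Bf] at *
  have h : (2 * (q * q')) ^ 2 ≤ (p * r' + r * p') ^ 2 := by
    have : (q * q') ^ 2 ≤ (p * r) * (p' * r') := by
      rw [mul_pow]; exact mul_le_mul h3 k3 (sq_nonneg _) (by positivity)
    nlinarith [sq_nonneg (p * r' - r * p')]
  have := abs_le_of_sq_le_sq h (by positivity)
  linarith [(abs_le.1 this).2]


/-! ### The action of `PSL2` -/

theorem mk_eq_mk_iff (A B : SL2) :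
    (QuotientGroup.mk A : PSL2) = QuotientGroup.mk B ↔ A = B ∨ A = -B := by
  rw [QuotientGroup.eq, Matrix.SpecialLinearGroup.mem_center_iff]
  constructor
  · rintro ⟨r, hr, h⟩
    have hr' : r = 1 ∨ r = -1 := by
      rw [Fintype.card_fin] at hr
      have h2 : (r - 1) * (r + 1) = 0 := by linear_combination hr
      rcases mul_eq_zero.1 h2 with h3 | h3
      · left; linarith
      · right; linarith
    have hB : (B : Matrix (Fin 2) (Fin 2) ℝ) = r • (A : Matrix (Fin 2) (Fin 2) ℝ) := by
      have : B = A * (A⁻¹ * B) := by group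
      rw [this, Matrix.SpecialLinearGroup.coe_mul, ← h]
      simp [Matrix.scalar_apply, ← Matrix.smul_eq_mul_diagonal]
    rcases hr' with rfl | rfl
    · left; ext i k; rw [hB]; simp
    · right; ext i k; rw [Matrix.SpecialLinearGroup.coe_neg, hB]; simp
  · rintro (rfl | rfl)
    · exact ⟨1, by simp, by simp⟩
    · refine ⟨-1, by simp, ?_⟩
      have : (-B)⁻¹ * B = -1 := by
        rw [inv_mul_eq_iff_eq_mul]; simp
      rw [this]
      ext i k
      simp [Matrix.scalar_apply, Matrix.diagonal_apply, Matrix.one_apply]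
      split_ifs <;> simp

theorem pslSMul_mk (A : SL2) (z : ℍ) : pslSMul (QuotientGroup.mk A) z = A • z := by
  unfold pslSMul
  have h : (QuotientGroup.mk (Quotient.out (QuotientGroup.mk A : PSL2)) : PSL2) = QuotientGroup.mk A :=
    QuotientGroup.out_eq' _
  rcases (mk_eq_mk_iff _ _).1 h with h | h
  · rw [h]
  · rw [h]; apply Pz_inj; rw [Pz_act, Pz_act, act_neg]

instance pslAction : MulAction PSL2 ℍ where
  smul g z := pslSMul g z
  one_smul z := by
    change pslSMul (QuotientGroup.mk 1) z = z
    rw [pslSMul_mk, one_smul]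
  mul_smul g h z := by
    obtain ⟨A, rfl⟩ := QuotientGroup.mk_surjective g
    obtain ⟨B, rfl⟩ := QuotientGroup.mk_surjective h
    change pslSMul (QuotientGroup.mk (A * B)) z = pslSMul _ (pslSMul _ z)
    rw [pslSMul_mk, pslSMul_mk, pslSMul_mk, mul_smul]

theorem psl_smul_def (g : PSL2) (z : ℍ) : pslSMul g z = g • z := rfl

theorem mk_smul (A : SL2) (z : ℍ) : (QuotientGroup.mk A : PSL2) • z = A • z := pslSMul_mk A z

theorem psl_dist (g : PSL2) (z w : ℍ) : dist (g • z) (g • w) = dist z w := by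
  obtain ⟨A, rfl⟩ := QuotientGroup.mk_surjective g
  rw [mk_smul, mk_smul, dist_smul]

/-! ### Sides -/

/-- The linear functional whose sign tells the side of the line `M·(iℝ)`. -/
def sd (M : SL2) (P : Tri) : ℝ := (act M⁻¹ P).2.1

/-- The line `M·(iℝ)`. -/
def lineOf (M : SL2) : Set ℍ := {z | sd M (Pz z) = 0}

/-- The half plane `M·{Re > 0}`. -/
def posOf (M : SL2) : Set ℍ := {z | 0 < sd M (Pz z)}

/-- The rotation by angle `π`. -/
def Sw : SL2 := ⟨!![0, -1; 1, 0], by simp [Matrix.det_fin_two]⟩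

theorem sd_add (M : SL2) (P Q : Tri) : sd M (P + Q) = sd M P + sd M Q := by
  simp [sd, act_add]

theorem sd_smul (M : SL2) (c : ℝ) (P : Tri) : sd M (c • P) = c * sd M P := by
  simp [sd, act_smul]

theorem sd_mul_act (G M : SL2) (P : Tri) : sd (G * M) (act G P) = sd M P := by
  simp only [sd, mul_inv_rev, act_mul, act_inv_act]

theorem sd_Sw (M : SL2) (P : Tri) : sd (M * Sw) P = - sd M P := by
  simp only [sd, mul_inv_rev, act_mul]
  generalize act M⁻¹ P = Q
  simp only [act, inv00, inv01, inv10, inv11]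
  simp [Sw]

theorem sd_neg (M : SL2) (P : Tri) : sd (-M) P = sd M P := by
  have : (-M)⁻¹ = -M⁻¹ := by
    rw [inv_eq_iff_mul_eq_one]; simp
  simp only [sd, this, act_neg]

theorem sd_smul_point (M : SL2) (z : ℍ) : sd M (Pz (M • z)) = (Pz z).2.1 := by
  rw [sd, Pz_act, act_inv_act]

theorem continuous_Pz : Continuous Pz := by
  unfold Pz
  have h1 : Continuous UpperHalfPlane.re := UpperHalfPlane.continuous_re
  have h2 : Continuous UpperHalfPlane.im := UpperHalfPlane.continuous_im
  have h3 : ∀ z : ℍ, z.im ≠ 0 := fun z => z.im_pos.ne'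
  exact Continuous.prodMk (by fun_prop (disch := assumption))
    (Continuous.prodMk (by fun_prop (disch := assumption)) (by fun_prop (disch := assumption)))

theorem continuous_act (M : SL2) : Continuous (act M) := by
  unfold act; fun_prop

theorem continuous_sd (M : SL2) : Continuous (sd M) :=
  (continuous_fst.comp continuous_snd).comp (continuous_act _)

theorem cone_of_Bf_pos {P X : Tri} (hP : Cone P) (hd : X.1 * X.2.2 - X.2.1 ^ 2 = 0)
    (hB : 0 < Bf P X) : Cone X := by
  have h0 : 0 ≤ X.1 * X.2.2 := by nlinarith [sq_nonneg X.2.1]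
  rcases mul_nonneg_iff.1 h0 with ⟨h1, h2⟩ | ⟨h1, h2⟩
  · exact ⟨h1, h2, by linarith⟩
  · exfalso
    have : Cone ((-1 : ℝ) • X) := by
      refine ⟨?_, ?_, ?_⟩ <;> simp <;> linarith
    have := hP.nonneg_Bf this
    rw [Bf_smul] at this
    linarith

theorem simul_diag (P Q : Tri) (hP : Cone P) (p3 : P.1 * P.2.2 - P.2.1 ^ 2 = 1)
    (q3 : Q.1 * Q.2.2 - Q.2.1 ^ 2 = 1) (e f : ℝ) (hef : 0 < e - f)
    (hee : e * f = 1) (hPQ : Bf P Q = e + f) :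
    ∃ M : SL2, act M (1, 0, 1) = P ∧ act M (e, 0, f) = Q := by
  have hPP : Bf P P = 2 := by simp only [Bf]; linear_combination 2 * p3
  have hQQ : Bf Q Q = 2 := by simp only [Bf]; linear_combination 2 * q3
  obtain ⟨k, hk⟩ : ∃ k, k = (e - f)⁻¹ := ⟨_, rfl⟩
  have hk0 : 0 < k := by rw [hk]; positivity
  have hk1 : k * (e - f) = 1 := by rw [hk]; exact inv_mul_cancel₀ hef.ne'
  obtain ⟨u, hu⟩ : ∃ u, k • (Q + (-f) • P) = vv u := by
    have d1 : (k • (Q + (-f) • P)).1 * (k • (Q + (-f) • P)).2.2 - (k • (Q + (-f) • P)).2.1 ^ 2 = 0 := by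
      simp only [Bf] at hPQ
      simp
      linear_combination k ^ 2 * (q3 + f ^ 2 * p3 - f * hPQ - hee)
    refine cone_rank_one (cone_of_Bf_pos hP d1 ?_) d1
    rw [Bf_smul, Bf_add, Bf_smul, hPQ, hPP]
    nlinarith
  obtain ⟨v, hv⟩ : ∃ v, k • (e • P + (-1 : ℝ) • Q) = vv v := by
    have d1 : (k • (e • P + (-1 : ℝ) • Q)).1 * (k • (e • P + (-1 : ℝ) • Q)).2.2
        - (k • (e • P + (-1 : ℝ) • Q)).2.1 ^ 2 = 0 := by
      simp only [Bf] at hPQ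
      simp
      linear_combination k ^ 2 * (q3 + e ^ 2 * p3 - e * hPQ - hee)
    refine cone_rank_one (cone_of_Bf_pos hP d1 ?_) d1
    rw [Bf_smul, Bf_add, Bf_smul, Bf_smul, hPQ, hPP]
    nlinarith
  have hdet : (u 0 * v 1 - u 1 * v 0) ^ 2 = 1 := by
    rw [← Bf_vv, ← hu, ← hv]
    simp only [Bf_smul, Bf_smul', Bf_add, Bf_add', hPP, hQQ, hPQ, Bf_comm Q P]
    linear_combination (k * (e - f) + 1) * hk1 + (2 * k ^ 2) * hee
  have eP : P = vv u + vv v := by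
    rw [← hu, ← hv]
    apply tri_ext <;> simp
    · linear_combination (-P.1) * hk1
    · linear_combination (-P.2.1) * hk1
    · linear_combination (-P.2.2) * hk1
  have eQ : Q = e • vv u + f • vv v := by
    rw [← hu, ← hv]
    apply tri_ext <;> simp
    · linear_combination (-Q.1) * hk1
    · linear_combination (-Q.2.1) * hk1
    · linear_combination (-Q.2.2) * hk1
  obtain ⟨ε, hε, hdet'⟩ : ∃ ε : ℝ, ε ^ 2 = 1 ∧ u 0 * (ε * v 1) - (ε * v 0) * u 1 = 1 := by
    refine ⟨u 0 * v 1 - u 1 * v 0, hdet, ?_⟩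
    linear_combination hdet
  let M : SL2 := ⟨!![u 0, ε * v 0; u 1, ε * v 1], by rw [Matrix.det_fin_two]; simpa using hdet'⟩
  refine ⟨M, ?_, ?_⟩
  · rw [eP]
    apply tri_ext <;> simp [act, M, vv]
    · linear_combination v 0 ^ 2 * hε
    · linear_combination v 0 * v 1 * hε
    · linear_combination v 1 ^ 2 * hε
  · rw [eQ]
    apply tri_ext <;> simp [act, M, vv]
    · linear_combination f * v 0 ^ 2 * hε
    · linear_combination f * v 0 * v 1 * hε
    · linear_combination f * v 1 ^ 2 * hε

/-- Classification of geodesic lines. -/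
theorem geodesic_line {l : Set ℍ} (h : IsGeodesicLine l) : ∃ M : SL2, l = lineOf M := by
  obtain ⟨γ, hγ, rfl⟩ := h
  have hcosh : ∀ s t : ℝ, Bf (Pz (γ s)) (Pz (γ t)) = Real.exp (s - t) + Real.exp (t - s) := by
    intro s t
    rw [← cosh_Bf, hγ.dist_eq, Real.dist_eq, Real.cosh_abs, Real.cosh_eq, neg_sub]; ring
  obtain ⟨e, he⟩ : ∃ e, e = Real.exp 1 := ⟨_, rfl⟩
  obtain ⟨f, hf⟩ : ∃ f, f = Real.exp (-1) := ⟨_, rfl⟩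
  have hef : 0 < e - f := by
    rw [he, hf, sub_pos, Real.exp_lt_exp]; norm_num
  have hee : e * f = 1 := by rw [he, hf, ← Real.exp_add]; simp
  obtain ⟨M, hMP, hMQ⟩ := simul_diag (Pz (γ 0)) (Pz (γ 1)) (Pz_cone _) (Pz_pos _).2.2
    (Pz_pos _).2.2 e f hef hee (by rw [hcosh, he, hf]; simp; ring)
  have key : ∀ t : ℝ, Pz (M⁻¹ • γ t) = (Real.exp t, 0, Real.exp (-t)) := by
    intro t
    have hT := Pz_pos (M⁻¹ • γ t)
    have e1 : Bf (Pz (M⁻¹ • γ t)) (1, 0, 1) = Real.exp t + Real.exp (-t) := by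
      rw [← Bf_act M, hMP, Pz_act, act_act_inv, hcosh]; simp
    have e2 : Bf (Pz (M⁻¹ • γ t)) (e, 0, f) = Real.exp t * f + Real.exp (-t) * e := by
      rw [← Bf_act M, hMQ, Pz_act, act_act_inv, hcosh, hf, he,
        show (1 : ℝ) - t = -t + 1 by ring, Real.exp_add, sub_eq_add_neg, Real.exp_add]
    generalize Pz (M⁻¹ • γ t) = T at *
    obtain ⟨x, y, z⟩ := T
    simp only [Bf] at e1 e2 hT
    obtain ⟨hx, hz, hxz⟩ := hT
    have hz' : z = Real.exp (-t) := by
      have : (e - f) * (z - Real.exp (-t)) = 0 := by linear_combination e2 - f * e1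
      rcases mul_eq_zero.1 this with h | h
      · linarith
      · linarith
    have hx' : x = Real.exp t := by linarith
    have hy : y = 0 := by
      have h1 : Real.exp t * Real.exp (-t) = 1 := by rw [← Real.exp_add]; simp
      rw [hx', hz', h1] at hxz
      have : y ^ 2 = 0 := by linarith
      exact pow_eq_zero_iff (two_ne_zero) |>.1 this
    rw [hx', hy, hz']
  refine ⟨M, ?_⟩
  ext w
  constructor
  · rintro ⟨t, rfl⟩
    show sd M (Pz (γ t)) = 0
    rw [sd, ← Pz_act, key]
  · intro hw
    change sd M (Pz w) = 0 at hw
    rw [sd, ← Pz_act] at hw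
    obtain ⟨h1, h2, h3⟩ := Pz_pos (M⁻¹ • w)
    rw [hw] at h3
    refine ⟨Real.log (Pz (M⁻¹ • w)).1, ?_⟩
    have : M⁻¹ • γ (Real.log (Pz (M⁻¹ • w)).1) = M⁻¹ • w := by
      apply Pz_inj
      rw [key, Real.exp_neg, Real.exp_log h1]
      refine tri_ext rfl hw.symm ?_
      simp only
      field_simp
      linarith
    exact smul_left_cancel _ this

/-! ### Classification of sides and of ideal points -/

theorem lineOf_Sw (M : SL2) : lineOf (M * Sw) = lineOf M := by
  ext z; simp [lineOf, sd_Sw]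

theorem posOf_Sw (M : SL2) : posOf (M * Sw) = {z | sd M (Pz z) < 0} := by
  ext z; simp [posOf, sd_Sw]

/-- The point `x + i y` with `y = exp t`. -/
def ptE (x t : ℝ) : ℍ := ⟨⟨x, Real.exp t⟩, Real.exp_pos t⟩

theorem ptE_re (x t : ℝ) : (ptE x t).re = x := rfl
theorem ptE_im (x t : ℝ) : (ptE x t).im = Real.exp t := rfl

theorem ptE_surj (z : ℍ) : z = ptE z.re (Real.log z.im) := by
  apply UpperHalfPlane.ext
  apply Complex.ext
  · rfl
  · show z.im = Real.exp (Real.log z.im)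
    rw [Real.exp_log z.im_pos]

theorem Pz_ptE (x t : ℝ) : Pz (ptE x t) = ((x ^ 2 + Real.exp t ^ 2) / Real.exp t, x / Real.exp t, 1 / Real.exp t) := rfl

theorem continuous_ptE : Continuous (fun p : ℝ × ℝ => ptE p.1 p.2) := by
  rw [UpperHalfPlane.isEmbedding_coe.continuous_iff]
  show Continuous (fun p : ℝ × ℝ => (⟨p.1, Real.exp p.2⟩ : ℂ))
  have : (fun p : ℝ × ℝ => (⟨p.1, Real.exp p.2⟩ : ℂ)) = fun p : ℝ × ℝ => (p.1 : ℂ) + (Real.exp p.2 : ℂ) * Complex.I := by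
    funext p; apply Complex.ext <;> simp [-Complex.ofReal_exp]
  rw [this]
  fun_prop

theorem posOf_preconnected (M : SL2) : IsPreconnected (posOf M) := by
  have : posOf M = Set.range (fun p : ℝ × ℝ => M • ptE (Real.exp p.1) p.2) := by
    ext z
    constructor
    · intro hz
      change 0 < sd M (Pz z) at hz
      rw [sd, ← Pz_act] at hz
      refine ⟨(Real.log (M⁻¹ • z).re, Real.log (M⁻¹ • z).im), ?_⟩
      have h1 : 0 < (M⁻¹ • z).re := by
        have h2 := (M⁻¹ • z).im_pos
        simp only [Pz] at hz
        rwa [div_pos_iff_of_pos_right h2] at hz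
      simp only
      rw [Real.exp_log h1, ← ptE_surj, smul_inv_smul]
    · rintro ⟨p, rfl⟩
      show 0 < sd M _
      rw [sd_smul_point, Pz_ptE]
      positivity
  rw [this]
  apply isPreconnected_range
  have h := continuous_ptE.comp (f := fun p : ℝ × ℝ => (Real.exp p.1, p.2)) (by fun_prop)
  exact h.const_smul M

theorem IsCC_posOf {M : SL2} {U : Set ℍ} (h : IsCC (lineOf M)ᶜ U) :
    ∃ N : SL2, lineOf N = lineOf M ∧ posOf N = U := by
  obtain ⟨x, hx, rfl⟩ := h
  have main : ∀ N : SL2, x ∈ posOf N → posOf N = connectedComponentIn (lineOf N)ᶜ x := by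
    intro N hN
    apply Set.Subset.antisymm
    · apply (posOf_preconnected N).subset_connectedComponentIn hN
      intro z hz hz'
      exact (ne_of_gt hz : sd N (Pz z) ≠ 0) hz'
    · intro y hy
      by_contra hy'
      have hy1 : sd N (Pz y) ≤ 0 := not_lt.1 hy'
      have hx1 : x ∈ connectedComponentIn (lineOf N)ᶜ x :=
        mem_connectedComponentIn (fun h' => (ne_of_gt hN : sd N (Pz x) ≠ 0) h')
      have hc : ContinuousOn (fun z => sd N (Pz z)) (connectedComponentIn (lineOf N)ᶜ x) :=
        ((continuous_sd N).comp continuous_Pz).continuousOn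
      obtain ⟨z, hz, hz0⟩ := isPreconnected_connectedComponentIn.intermediate_value hy hx1 hc
        (show (0 : ℝ) ∈ Set.Icc _ _ from ⟨hy1, le_of_lt hN⟩)
      exact connectedComponentIn_subset _ _ hz hz0
  have hx0 : sd M (Pz x) ≠ 0 := hx
  rcases lt_or_gt_of_ne hx0 with h | h
  · refine ⟨M * Sw, lineOf_Sw M, ?_⟩
    rw [← lineOf_Sw]
    apply main
    rw [posOf_Sw]; exact h
  · exact ⟨M, rfl, main M h⟩

theorem exists_side {l U : Set ℍ} (hl : IsGeodesicLine l) (hU : IsCC lᶜ U) :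
    ∃ M : SL2, l = lineOf M ∧ U = posOf M := by
  obtain ⟨M, rfl⟩ := geodesic_line hl
  obtain ⟨N, h1, h2⟩ := IsCC_posOf hU
  exact ⟨N, h1.symm, h2.symm⟩

theorem closure_posOf (M : SL2) : closure (posOf M) = {z | 0 ≤ sd M (Pz z)} := by
  apply Set.Subset.antisymm
  · apply closure_minimal
    · intro z hz; exact le_of_lt (show 0 < sd M (Pz z) from hz)
    · exact isClosed_le continuous_const ((continuous_sd M).comp continuous_Pz)
  · intro z hz
    have ht : Tendsto (fun ε : ℝ => M • ptE ((M⁻¹ • z).re + ε) (Real.log (M⁻¹ • z).im)) (𝓝[>] 0) (𝓝 z) := by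
      have hc : Continuous (fun ε : ℝ => M • ptE ((M⁻¹ • z).re + ε) (Real.log (M⁻¹ • z).im)) := by
        have h := continuous_ptE.comp (f := fun ε : ℝ => ((M⁻¹ • z).re + ε, Real.log (M⁻¹ • z).im)) (by fun_prop)
        exact h.const_smul M
      have h0 := hc.tendsto 0
      simp only [add_zero] at h0
      rw [← ptE_surj, smul_inv_smul] at h0
      exact h0.mono_left nhdsWithin_le_nhds
    apply mem_closure_of_tendsto ht
    filter_upwards [self_mem_nhdsWithin] with ε hε
    show 0 < sd M _
    rw [sd_smul_point, Pz_ptE]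
    have hz' : 0 ≤ sd M (Pz z) := hz
    rw [sd, ← Pz_act] at hz'
    simp only [Pz] at hz'
    have hz'' : 0 ≤ (M⁻¹ • z).re := by
      have h5 := mul_nonneg hz' (M⁻¹ • z).im_pos.le
      rwa [div_mul_cancel₀ _ (M⁻¹ • z).im_pos.ne'] at h5
    have : (0 : ℝ) < ε := hε
    positivity

theorem lineOf_eq_of_posOf_eq {M N : SL2} (h : posOf M = posOf N) : lineOf M = lineOf N := by
  have key : ∀ M : SL2, lineOf M = closure (posOf M) \ posOf M := by
    intro M
    rw [closure_posOf]
    ext z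
    simp only [lineOf, posOf, Set.mem_ofPred_eq, Set.mem_sdiff, not_lt]
    exact ⟨fun h => ⟨h.ge, h.le⟩, fun h => le_antisymm h.2 h.1⟩
  rw [key, key, h]

theorem toC_coe (x : ℝ) : toC (x : OnePoint ℝ) = ((x : ℂ) : OnePoint ℂ) := rfl
theorem toC_infty : toC OnePoint.infty = OnePoint.infty := rfl
theorem bvec_coe (x : ℝ) : bvec (x : OnePoint ℝ) = ![x, 1] := rfl
theorem bvec_infty : bvec OnePoint.infty = ![1, 0] := rfl

theorem tendsto_embH {α : Type*} {F : Filter α} (f : α → ℍ) (ξ : OnePoint ℝ) :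
    Tendsto (fun n => embH (f n)) F (𝓝 (toC ξ)) ↔
      ∃ c : α → ℝ, (∀ n, 0 < c n) ∧ Tendsto (fun n => c n • Pz (f n)) F (𝓝 (vv (bvec ξ))) := by
  have hre : ∀ z : ℍ, z.re = (Pz z).2.1 / (Pz z).2.2 := by
    intro z; have := z.im_pos; simp only [Pz]; field_simp
  have hsq : ∀ z : ℍ, Complex.normSq (z : ℂ) = (Pz z).1 / (Pz z).2.2 := by
    intro z; have := z.im_pos; simp only [Pz, Complex.normSq_apply, UpperHalfPlane.coe_re, UpperHalfPlane.coe_im]; field_simp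
  induction ξ using OnePoint.rec with
  | infty =>
    have e1 : Tendsto (fun n => embH (f n)) F (𝓝 (toC OnePoint.infty)) ↔
        Tendsto (fun n => Complex.normSq (f n : ℂ)) F atTop := by
      rw [toC_infty]
      have : Tendsto (fun n => embH (f n)) F (𝓝 OnePoint.infty) ↔
          Tendsto (fun n => (f n : ℂ)) F (coclosedCompact ℂ) := by
        rw [← OnePoint.comap_coe_nhds_infty, tendsto_comap_iff]; rfl
      rw [this, coclosedCompact_eq_cocompact, ← Metric.cobounded_eq_cocompact, ← tendsto_norm_atTop_iff_cobounded]
      have h2 : (fun n => Complex.normSq (f n : ℂ)) = fun n => ‖(f n : ℂ)‖ ^ 2 := by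
        funext n; rw [Complex.normSq_eq_norm_sq]
      rw [h2]
      constructor
      · intro h; exact (tendsto_pow_atTop two_ne_zero).comp h
      · intro h
        have := Real.tendsto_sqrt_atTop.comp h
        refine this.congr ?_
        intro n; simp
    rw [e1, bvec_infty]
    constructor
    · intro h
      refine ⟨fun n => ((Pz (f n)).1)⁻¹, fun n => inv_pos.2 (Pz_pos _).1, ?_⟩
      have h3 : Tendsto (fun n => (Pz (f n)).2.2 / (Pz (f n)).1) F (𝓝 0) := by
        have := tendsto_inv_atTop_zero.comp h
        refine this.congr ?_
        intro n; simp only [Function.comp]; rw [hsq, inv_div]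
      have h2 : Tendsto (fun n => (Pz (f n)).2.1 / (Pz (f n)).1) F (𝓝 0) := by
        have h3' := (Real.continuous_sqrt.tendsto 0).comp h3
        rw [Real.sqrt_zero] at h3'
        refine squeeze_zero_norm ?_ h3'
        intro n
        simp only [Function.comp]
        rw [Real.norm_eq_abs]
        apply Real.abs_le_sqrt
        obtain ⟨a, b, c⟩ := Pz_pos (f n)
        rw [div_pow, div_le_div_iff₀ (by positivity) (by positivity)]
        nlinarith [sq_nonneg (Pz (f n)).2.1]
      have h1 : Tendsto (fun n => ((Pz (f n)).1)⁻¹ * (Pz (f n)).1) F (𝓝 1) := by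
        refine tendsto_const_nhds.congr ?_
        intro n; rw [inv_mul_cancel₀ (Pz_pos _).1.ne']
      have : vv ![1, 0] = (1, 0, 0) := by simp [vv]
      rw [this]
      refine h1.prodMk_nhds (Tendsto.prodMk_nhds ?_ ?_)
      · refine h2.congr ?_; intro n; simp only [Prod.smul_snd, Prod.smul_fst, smul_eq_mul]; rw [div_eq_inv_mul]
      · refine h3.congr ?_; intro n; simp only [Prod.smul_snd, Prod.smul_fst, smul_eq_mul]; rw [div_eq_inv_mul]
    · rintro ⟨c, hc, h⟩
      have h1 : Tendsto (fun n => c n * (Pz (f n)).1) F (𝓝 1) := by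
        have := (continuous_fst.tendsto _).comp h
        simpa [vv, Function.comp_def] using this
      have h2 : Tendsto (fun n => c n * (Pz (f n)).2.2) F (𝓝[>] 0) := by
        rw [tendsto_nhdsWithin_iff]
        refine ⟨?_, Eventually.of_forall fun n => mul_pos (hc n) (Pz_pos _).2.1⟩
        have := ((continuous_snd.comp continuous_snd).tendsto _).comp h
        simpa [vv, Function.comp_def] using this
      have h3 := h1.pos_mul_atTop one_pos h2.inv_tendsto_nhdsGT_zero
      refine h3.congr ?_
      intro n
      have := hc n
      have := (Pz_pos (f n)).2.1
      rw [hsq]; simp only [Pi.inv_apply]; field_simp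
  | coe x =>
    have e1 : Tendsto (fun n => embH (f n)) F (𝓝 (toC (x : OnePoint ℝ))) ↔
        Tendsto (fun n => (f n : ℂ)) F (𝓝 (x : ℂ)) := by
      rw [toC_coe]
      exact (OnePoint.isOpenEmbedding_coe.isEmbedding.tendsto_nhds_iff).symm
    rw [e1, bvec_coe]
    have hx : vv ![x, 1] = (x ^ 2, x, 1) := by simp [vv]
    rw [hx]
    constructor
    · intro h
      refine ⟨fun n => ((Pz (f n)).2.2)⁻¹, fun n => inv_pos.2 (Pz_pos _).2.1, ?_⟩
      refine Tendsto.prodMk_nhds ?_ (Tendsto.prodMk_nhds ?_ ?_)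
      · have := (Complex.continuous_normSq.tendsto _).comp h
        rw [Complex.normSq_ofReal, ← sq] at this
        refine this.congr ?_
        intro n; simp only [Function.comp]; rw [hsq, div_eq_inv_mul]; simp
      · have := (Complex.continuous_re.tendsto _).comp h
        rw [Complex.ofReal_re] at this
        refine this.congr ?_
        intro n; simp only [Function.comp, UpperHalfPlane.coe_re]; rw [hre, div_eq_inv_mul]; simp
      · refine tendsto_const_nhds.congr ?_
        intro n; simp only [Prod.smul_snd, Prod.smul_fst, smul_eq_mul]; rw [inv_mul_cancel₀ (Pz_pos _).2.1.ne']
    · rintro ⟨c, hc, h⟩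
      have h1 : Tendsto (fun n => c n * (Pz (f n)).1) F (𝓝 (x ^ 2)) := by
        have := (continuous_fst.tendsto _).comp h
        simpa [Function.comp_def] using this
      have h2 : Tendsto (fun n => c n * (Pz (f n)).2.1) F (𝓝 x) := by
        have := ((continuous_fst.comp continuous_snd).tendsto _).comp h
        simpa [Function.comp_def] using this
      have h3 : Tendsto (fun n => c n * (Pz (f n)).2.2) F (𝓝 1) := by
        have := ((continuous_snd.comp continuous_snd).tendsto _).comp h
        simpa [Function.comp_def] using this
      have k1 : Tendsto (fun n => (f n).re) F (𝓝 x) := by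
        have := h2.div h3 one_ne_zero
        rw [div_one] at this
        refine this.congr ?_
        intro n
        have := (hc n).ne'
        have := (Pz_pos (f n)).2.1.ne'
        simp only [Pi.div_apply]
        rw [hre]; field_simp
      have k2 : Tendsto (fun n => Complex.normSq (f n : ℂ)) F (𝓝 (x ^ 2)) := by
        have := h1.div h3 one_ne_zero
        rw [div_one] at this
        refine this.congr ?_
        intro n
        have := (hc n).ne'
        have := (Pz_pos (f n)).2.1.ne'
        simp only [Pi.div_apply]
        rw [hsq]; field_simp
      have k3 : Tendsto (fun n => (f n).im) F (𝓝 0) := by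
        have h4 := (Real.continuous_sqrt.tendsto _).comp (k2.sub (k1.pow 2))
        rw [sub_self, Real.sqrt_zero] at h4
        refine h4.congr ?_
        intro n
        simp only [Function.comp, Complex.normSq_apply, UpperHalfPlane.coe_re, UpperHalfPlane.coe_im]
        rw [show (f n).re * (f n).re + (f n).im * (f n).im - (f n).re ^ 2 = (f n).im ^ 2 by ring, Real.sqrt_sq (f n).im_pos.le]
      have k4 : Tendsto (fun n => ((f n).re : ℂ) + ((f n).im : ℂ) * Complex.I) F (𝓝 ((x : ℂ) + ((0 : ℝ) : ℂ) * Complex.I)) :=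
        ((Complex.continuous_ofReal.tendsto _).comp k1).add
          (((Complex.continuous_ofReal.tendsto _).comp k3).mul_const _)
      simp only [Complex.ofReal_zero, zero_mul, add_zero] at k4
      refine k4.congr ?_
      intro n; apply Complex.ext <;> simp

theorem sd_nonneg_of_tendsto {α : Type*} {F : Filter α} [NeBot F] {M : SL2} {f : α → ℍ} {ξ : OnePoint ℝ}
    (h : Tendsto (fun n => embH (f n)) F (𝓝 (toC ξ))) (hf : ∀ n, 0 ≤ sd M (Pz (f n))) :
    0 ≤ sd M (vv (bvec ξ)) := by
  obtain ⟨c, hc, ht⟩ := (tendsto_embH f ξ).1 h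
  refine ge_of_tendsto (((continuous_sd M).tendsto _).comp ht) (Eventually.of_forall fun n => ?_)
  simp only [Function.comp, sd_smul]
  exact mul_nonneg (hc n).le (hf n)

theorem bvec_ne (ξ : OnePoint ℝ) : vv (bvec ξ) ≠ 0 := by
  induction ξ using OnePoint.rec with
  | infty => rw [bvec_infty]; intro h; have := congrArg Prod.fst h; simp [vv] at this
  | coe x => rw [bvec_coe]; intro h; have := congrArg (fun p => p.2.2) h; simp [vv] at this

theorem exists_bvec {v : Fin 2 → ℝ} (hv : v ≠ 0) : ∃ ξ : OnePoint ℝ, ∃ c : ℝ, c ≠ 0 ∧ v = c • bvec ξ := by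
  by_cases h : v 1 = 0
  · refine ⟨OnePoint.infty, v 0, ?_, ?_⟩
    · intro h0; apply hv; funext i; fin_cases i <;> simp [h, h0]
    · rw [bvec_infty]; funext i; fin_cases i <;> simp [h]
  · refine ⟨((v 0 / v 1 : ℝ) : OnePoint ℝ), v 1, h, ?_⟩
    rw [bvec_coe]; funext i; fin_cases i <;> simp; field_simp

theorem vv_smul (c : ℝ) (v : Fin 2 → ℝ) : vv (c • v) = c ^ 2 • vv v := by
  apply tri_ext <;> simp [vv] <;> ring

theorem posOf_nonempty (M : SL2) : (posOf M).Nonempty :=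
  ⟨M • ptE 1 0, by show 0 < sd M _; rw [sd_smul_point, Pz_ptE]; positivity⟩

theorem isIdealPoint_iff (M : SL2) (ξ : OnePoint ℝ) :
    IsIdealPoint (posOf M) ξ ↔ 0 ≤ sd M (vv (bvec ξ)) := by
  constructor
  · rintro ⟨u, hu, ht⟩
    exact sd_nonneg_of_tendsto ht fun n => le_of_lt (hu n)
  · intro h
    obtain ⟨w, hw⟩ := posOf_nonempty M
    have hw' : 0 < sd M (Pz w) := hw
    have ex : ∀ n : ℕ, ∃ z : ℍ, ∃ c : ℝ, 0 < c ∧ vv (bvec ξ) + ((1 : ℝ) / (n + 1)) • Pz w = c • Pz z := by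
      intro n
      have hn : (0 : ℝ) < 1 / (n + 1) := by positivity
      generalize (1 : ℝ) / (n + 1) = ε at hn
      obtain ⟨p1, p2, p3⟩ := Pz_pos w
      apply exists_Pz
      · simp only [Prod.fst_add, Prod.smul_fst, smul_eq_mul]
        have := (vv_cone (bvec ξ)).1
        positivity
      · have hb := (vv_cone (bvec ξ)).nonneg_Bf (Pz_cone w)
        simp only [Bf] at hb
        simp only [Prod.fst_add, Prod.snd_add, Prod.smul_fst, Prod.smul_snd, smul_eq_mul]
        have h3 : (vv (bvec ξ)).1 * (vv (bvec ξ)).2.2 - (vv (bvec ξ)).2.1 ^ 2 = 0 := by simp [vv]; ring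
        generalize vv (bvec ξ) = V at *
        have : (V.1 + ε * (Pz w).1) * (V.2.2 + ε * (Pz w).2.2) - (V.2.1 + ε * (Pz w).2.1) ^ 2
          = ε * (V.1 * (Pz w).2.2 + V.2.2 * (Pz w).1 - 2 * V.2.1 * (Pz w).2.1) + ε ^ 2 := by
          linear_combination h3 + ε ^ 2 * p3
        rw [this]
        positivity
    choose z c hc hz using ex
    refine ⟨z, ?_, ?_⟩
    · intro n
      have h1 : sd M (c n • Pz (z n)) = sd M (vv (bvec ξ)) + (1 : ℝ) / (n + 1) * sd M (Pz w) := by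
        rw [← hz, sd_add, sd_smul]
      rw [sd_smul] at h1
      have h2 : (0 : ℝ) < 1 / (n + 1) := by positivity
      have h3 : 0 < c n * sd M (Pz (z n)) := by rw [h1]; positivity
      exact (mul_pos_iff_of_pos_left (hc n)).1 h3
    · rw [tendsto_embH]
      refine ⟨c, hc, ?_⟩
      have h1 := (tendsto_one_div_add_atTop_nhds_zero_nat (𝕜 := ℝ)).smul_const (Pz w)
      have h2 := h1.const_add (vv (bvec ξ))
      rw [zero_smul, add_zero] at h2
      exact h2.congr hz

theorem isEndpoint_iff (M : SL2) (ξ : OnePoint ℝ) :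
    IsEndpoint (lineOf M) ξ ↔ sd M (vv (bvec ξ)) = 0 := by
  constructor
  · rintro ⟨γ, hγ, hr, ht⟩
    have h0 : ∀ t, sd M (Pz (γ t)) = 0 := fun t => by
      have : γ t ∈ lineOf M := hr ▸ Set.mem_range_self t
      exact this
    have h1 := sd_nonneg_of_tendsto (M := M) ht fun n => (h0 n).ge
    have h2 := sd_nonneg_of_tendsto (M := M * Sw) ht fun n => by rw [sd_Sw, h0]; simp
    rw [sd_Sw] at h2
    linarith
  · intro h
    have main : ∀ N : SL2, ((N⁻¹ : SL2) : Matrix (Fin 2) (Fin 2) ℝ).mulVec (bvec ξ) 1 = 0 → IsEndpoint (lineOf N) ξ := by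
      intro N hN
      refine ⟨fun t => N • ptE 0 t, ?_, ?_, ?_⟩
      · intro s t
        rw [edist_dist, edist_dist, dist_smul]
        exact congrArg _ ((UpperHalfPlane.isometry_vertical_line 0).dist_eq s t)
      · ext z
        constructor
        · rintro ⟨t, rfl⟩
          show sd N _ = 0
          rw [sd_smul_point, Pz_ptE]; simp
        · intro hz
          change sd N (Pz z) = 0 at hz
          rw [sd, ← Pz_act] at hz
          have h0 : (N⁻¹ • z).re = 0 := by
            have := (N⁻¹ • z).im_pos
            simp only [Pz] at hz
            rcases div_eq_zero_iff.1 hz with h | h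
            · exact h
            · linarith
          refine ⟨Real.log (N⁻¹ • z).im, ?_⟩
          simp only
          rw [← h0, ← ptE_surj, smul_inv_smul]
      · rw [tendsto_embH]
        have hw : vv (bvec ξ) = act N (((((N⁻¹ : SL2) : Matrix (Fin 2) (Fin 2) ℝ).mulVec (bvec ξ) 0) ^ 2) • (1, 0, 0)) := by
          rw [← act_act_inv N (vv (bvec ξ)), act_vv]
          congr 1
          generalize ((N⁻¹ : SL2) : Matrix (Fin 2) (Fin 2) ℝ).mulVec (bvec ξ) = w at hN
          apply tri_ext <;> simp [vv, hN]
        generalize (((N⁻¹ : SL2) : Matrix (Fin 2) (Fin 2) ℝ).mulVec (bvec ξ) 0) = k at hw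
        have hk : k ≠ 0 := by
          rintro rfl
          apply bvec_ne ξ
          rw [hw]; apply tri_ext <;> simp [act]
        refine ⟨fun t => k ^ 2 * Real.exp (-t), fun t => by positivity, ?_⟩
        rw [hw]
        have : ∀ t, (k ^ 2 * Real.exp (-t)) • Pz (N • ptE 0 t) = act N ((k ^ 2) • (1, 0, Real.exp (-t) ^ 2)) := by
          intro t
          rw [Pz_act, ← act_smul]
          congr 1
          rw [Pz_ptE]
          apply tri_ext <;> simp [Real.exp_neg]
          · field_simp
          · ring
        simp only [this]
        refine ((continuous_act N).tendsto _).comp ?_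
        have h1 : Tendsto (fun t : ℝ => Real.exp (-t) ^ 2) atTop (𝓝 (0 ^ 2)) :=
          (Real.tendsto_exp_neg_atTop_nhds_zero).pow 2
        rw [zero_pow two_ne_zero] at h1
        exact (tendsto_const_nhds.prodMk_nhds (tendsto_const_nhds.prodMk_nhds h1)).const_smul _
    rw [sd, act_vv] at h
    have h' : ((M⁻¹ : SL2) : Matrix (Fin 2) (Fin 2) ℝ).mulVec (bvec ξ) 0 *
      ((M⁻¹ : SL2) : Matrix (Fin 2) (Fin 2) ℝ).mulVec (bvec ξ) 1 = 0 := h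
    rcases mul_eq_zero.1 h' with h0 | h0
    · rw [← lineOf_Sw]
      apply main
      rw [mul_inv_rev, Matrix.SpecialLinearGroup.coe_mul, ← Matrix.mulVec_mulVec]
      generalize ((M⁻¹ : SL2) : Matrix (Fin 2) (Fin 2) ℝ).mulVec (bvec ξ) = w at *
      have e1 : (Sw⁻¹ : SL2) 1 1 = 0 := by rw [inv11]; rfl
      simp only [Matrix.mulVec, dotProduct, Fin.sum_univ_two, h0, e1]; simp
    · exact main M h0

/-! ### Crooked half-spaces via fixed vectors in the cone -/

/-- `P` is a fixed direction of `A` in the cone, with multiplier at most one. -/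
def Fx (A : SL2) (P : Tri) : Prop := Cone P ∧ P ≠ 0 ∧ ∃ s : ℝ, s ≤ 1 ∧ act A P = s • P

/-- The closed half-space. -/
def CS (M : SL2) : Set PSL2 :=
  {h | ∃ A : SL2, (QuotientGroup.mk A : PSL2) = h ∧ ∃ P, Fx A P ∧ 0 ≤ sd M P}

/-- The open half-space. -/
def OS (M : SL2) : Set PSL2 :=
  {h | h ≠ 1 ∧ ∃ A : SL2, (QuotientGroup.mk A : PSL2) = h ∧ ∃ P, Fx A P ∧ 0 < sd M P}

theorem Fx_neg {A : SL2} {P : Tri} (h : Fx A P) : Fx (-A) P := by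
  obtain ⟨h1, h2, s, hs, h3⟩ := h
  exact ⟨h1, h2, s, hs, by rw [act_neg, h3]⟩

theorem mem_CS {M A : SL2} : (QuotientGroup.mk A : PSL2) ∈ CS M ↔ ∃ P, Fx A P ∧ 0 ≤ sd M P := by
  constructor
  · rintro ⟨B, hB, P, hP, h⟩
    rcases (mk_eq_mk_iff _ _).1 hB with rfl | rfl
    · exact ⟨P, hP, h⟩
    · exact ⟨P, by simpa using Fx_neg hP, h⟩
  · rintro h; exact ⟨A, rfl, h⟩

theorem mem_OS {M A : SL2} : (QuotientGroup.mk A : PSL2) ∈ OS M ↔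
    (QuotientGroup.mk A : PSL2) ≠ 1 ∧ ∃ P, Fx A P ∧ 0 < sd M P := by
  constructor
  · rintro ⟨h1, B, hB, P, hP, h⟩
    rcases (mk_eq_mk_iff _ _).1 hB with rfl | rfl
    · exact ⟨h1, P, hP, h⟩
    · exact ⟨h1, P, by simpa using Fx_neg hP, h⟩
  · rintro ⟨h1, h⟩; exact ⟨h1, A, rfl, h⟩

theorem cone_zero {P : Tri} (h : Cone P) (h1 : P.1 = 0) (h2 : P.2.2 = 0) : P = 0 := by
  have := h.2.2
  rw [h1, zero_mul] at this
  have h3 : P.2.1 = 0 := by nlinarith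
  exact tri_ext h1 h3 h2

theorem cone_scale_pos {P : Tri} {c : ℝ} (h : Cone P) (h0 : P ≠ 0) (h' : Cone (c • P)) (h0' : c • P ≠ 0) :
    0 < c := by
  by_contra hc
  have hc0 : c ≠ 0 := by rintro rfl; simp at h0'
  have hc' : c < 0 := lt_of_le_of_ne (not_lt.1 hc) hc0
  apply h0
  have a1 := h'.1
  have a2 := h'.2.1
  simp only [Prod.smul_fst, Prod.smul_snd, smul_eq_mul] at a1 a2
  apply cone_zero h
  · nlinarith [h.1]
  · nlinarith [h.2.1]

theorem Fx_cases {A : SL2} {P : Tri} (h : Fx A P) :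
    (∃ z : ℍ, ∃ c : ℝ, 0 < c ∧ P = c • Pz z ∧ A • z = z) ∨
    (∃ ξ : OnePoint ℝ, ∃ c : ℝ, 0 < c ∧ P = c • vv (bvec ξ) ∧ HasNonattracting (QuotientGroup.mk A) ξ) := by
  obtain ⟨hc, h0, s, hs, hA⟩ := h
  rcases lt_or_eq_of_le (sub_nonneg.2 hc.2.2) with hd | hd
  · left
    have hp : 0 < P.1 := by
      rcases lt_or_eq_of_le hc.1 with h | h
      · exact h
      · rw [← h] at hd; nlinarith [sq_nonneg P.2.1]
    obtain ⟨z, c, hc0, rfl⟩ := exists_Pz hp hd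
    refine ⟨z, c, hc0, rfl, ?_⟩
    rw [act_smul, ← Pz_act, smul_comm] at hA
    have hA' : Pz (A • z) = s • Pz z := smul_right_injective _ hc0.ne' hA
    have d1 := Pz_pos (A • z)
    have d2 := Pz_pos z
    rw [hA'] at d1
    simp only [Prod.smul_fst, Prod.smul_snd, smul_eq_mul] at d1
    have hs0 : 0 < s := (pos_iff_pos_of_mul_pos d1.1).2 d2.1
    have hs2 : s ^ 2 = 1 := by
      have := d1.2.2; have := d2.2.2
      linear_combination d1.2.2 - s ^ 2 * d2.2.2
    have : s = 1 := by nlinarith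
    apply Pz_inj
    rw [hA', this, one_smul]
  · right
    obtain ⟨v, rfl⟩ := cone_rank_one hc hd.symm
    have hv : v ≠ 0 := by rintro rfl; apply h0; simp [vv]
    obtain ⟨ξ, c, hc0, rfl⟩ := exists_bvec hv
    refine ⟨ξ, c ^ 2, by positivity, vv_smul _ _, A, rfl, ?_⟩
    rw [vv_smul, act_smul, smul_comm] at hA
    have hA' : act A (vv (bvec ξ)) = s • vv (bvec ξ) :=
      smul_right_injective _ (pow_ne_zero 2 hc0) hA
    rw [act_vv] at hA'
    have hb := bvec_ne ξ
    have hB : Bf (vv (bvec ξ)) (vv ((A : Matrix (Fin 2) (Fin 2) ℝ).mulVec (bvec ξ))) = 0 := by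
      rw [hA', Bf_smul, Bf_vv]; ring
    rw [Bf_vv] at hB
    generalize (A : Matrix (Fin 2) (Fin 2) ℝ).mulVec (bvec ξ) = w at *
    generalize bvec ξ = b at *
    have hB' : b 0 * w 1 - b 1 * w 0 = 0 := by simpa using hB
    have hbn : b 0 ≠ 0 ∨ b 1 ≠ 0 := by
      by_contra hh; push Not at hh
      apply hb; simp [vv, hh]
    have hw : ∃ μ : ℝ, w = μ • b := by
      rcases hbn with h | h
      · refine ⟨w 0 / b 0, ?_⟩
        funext i; fin_cases i <;> simp <;> field_simp
        linarith
      · refine ⟨w 1 / b 1, ?_⟩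
        funext i; fin_cases i <;> simp <;> field_simp
        linarith
    obtain ⟨μ, rfl⟩ := hw
    refine ⟨μ, ?_, rfl⟩
    rw [vv_smul] at hA'
    have : μ ^ 2 = s := smul_left_injective _ hb hA'
    rw [← sq_le_one_iff_abs_le_one, this]
    exact hs

theorem Fx_of_fixed {A : SL2} {z : ℍ} (h : A • z = z) : Fx A (Pz z) := by
  refine ⟨Pz_cone z, ?_, 1, le_refl _, ?_⟩
  · intro h0; have := (Pz_pos z).1; rw [h0] at this; simp at this
  · rw [one_smul, ← Pz_act, h]

theorem Fx_of_nonattracting {h : PSL2} {ξ : OnePoint ℝ} (hn : HasNonattracting h ξ) :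
    ∃ A : SL2, (QuotientGroup.mk A : PSL2) = h ∧ Fx A (vv (bvec ξ)) := by
  obtain ⟨A, hA, μ, hμ, h1⟩ := hn
  refine ⟨A, hA, vv_cone _, bvec_ne ξ, μ ^ 2, (sq_le_one_iff_abs_le_one μ).2 hμ, ?_⟩
  rw [act_vv, h1, vv_smul]

theorem closedRHS_eq (M : SL2) : closedRHS (lineOf M) (posOf M) = CS M := by
  ext h
  constructor
  · rintro (⟨x, hx, hfix⟩ | ⟨ξ, hξ, hn⟩)
    · obtain ⟨A, rfl⟩ := QuotientGroup.mk_surjective h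
      rw [pslSMul_mk] at hfix
      rw [mem_CS]
      refine ⟨Pz x, Fx_of_fixed hfix, ?_⟩
      rcases hx with hx | hx
      · exact (show sd M (Pz x) = 0 from hx).ge
      · exact (show 0 < sd M (Pz x) from hx).le
    · obtain ⟨A, rfl, hA⟩ := Fx_of_nonattracting hn
      rw [mem_CS]
      exact ⟨_, hA, (isIdealPoint_iff M ξ).1 hξ⟩
  · rintro ⟨A, rfl, P, hP, hs⟩
    rcases Fx_cases hP with ⟨z, c, hc, rfl, hz⟩ | ⟨ξ, c, hc, rfl, hn⟩
    · left
      refine ⟨z, ?_, by rw [pslSMul_mk, hz]⟩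
      rw [sd_smul] at hs
      have hs' : 0 ≤ sd M (Pz z) := nonneg_of_mul_nonneg_right hs hc
      rcases eq_or_lt_of_le hs' with h | h
      · left; exact h.symm
      · right; exact h
    · right
      rw [sd_smul] at hs
      exact ⟨ξ, (isIdealPoint_iff M ξ).2 (nonneg_of_mul_nonneg_right hs hc), hn⟩

theorem openRHS_eq (M : SL2) : openRHS (lineOf M) (posOf M) = OS M := by
  ext h
  constructor
  · rintro ⟨h1, ⟨x, hx, hfix⟩ | ⟨ξ, hξ, hξ', hn⟩⟩
    · obtain ⟨A, rfl⟩ := QuotientGroup.mk_surjective h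
      rw [pslSMul_mk] at hfix
      rw [mem_OS]
      exact ⟨h1, Pz x, Fx_of_fixed hfix, hx⟩
    · obtain ⟨A, rfl, hA⟩ := Fx_of_nonattracting hn
      rw [mem_OS]
      refine ⟨h1, _, hA, ?_⟩
      rw [isEndpoint_iff] at hξ'
      exact lt_of_le_of_ne ((isIdealPoint_iff M ξ).1 hξ) (Ne.symm hξ')
  · rintro ⟨h1, A, rfl, P, hP, hs⟩
    refine ⟨h1, ?_⟩
    rcases Fx_cases hP with ⟨z, c, hc, rfl, hz⟩ | ⟨ξ, c, hc, rfl, hn⟩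
    · left
      refine ⟨z, ?_, by rw [pslSMul_mk, hz]⟩
      rw [sd_smul] at hs
      exact (mul_pos_iff_of_pos_left hc).1 hs
    · right
      rw [sd_smul] at hs
      have hs' := (mul_pos_iff_of_pos_left hc).1 hs
      exact ⟨ξ, (isIdealPoint_iff M ξ).2 hs'.le, by rw [isEndpoint_iff]; exact hs'.ne', hn⟩

theorem exists_Fx (A : SL2) : ∃ P, Fx A P := by
  have hdet := sl_det A
  rcases lt_or_ge ((A 0 0 + A 1 1) ^ 2) 4 with ht | ht
  · have key : ∀ σ : ℝ, σ ^ 2 = 1 → 0 ≤ σ * A 1 0 → 0 ≤ σ * (-A 0 1) → Fx A (σ • (-2 * A 0 1, A 0 0 - A 1 1, 2 * A 1 0)) := by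
      intro σ hσ h1 h2
      have hbc : 0 < -(A 0 1 * A 1 0) := by nlinarith [sq_nonneg (A 0 0 - A 1 1)]
      refine ⟨⟨?_, ?_, ?_⟩, ?_, 1, le_refl _, ?_⟩
      · simp; linarith
      · simp; linarith
      · simp; nlinarith
      · intro h
        have h3 := congrArg (fun p => p.2.2) h
        simp at h3
        rcases h3 with h3 | h3
        · rw [h3] at hσ; norm_num at hσ
        · rw [h3] at hbc; simp at hbc
      · rw [one_smul, act_smul]
        congr 1
        apply tri_ext <;> simp only [act]
        · linear_combination (-2 * A 0 1) * hdet
        · linear_combination (A 0 0 - A 1 1) * hdet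
        · linear_combination (2 * A 1 0) * hdet
    have hbc : 0 < -(A 0 1 * A 1 0) := by nlinarith [sq_nonneg (A 0 0 - A 1 1)]
    rcases le_total 0 (A 1 0) with hc | hc
    · refine ⟨_, key 1 (by norm_num) (by linarith) ?_⟩
      by_contra hh; push Not at hh; nlinarith
    · refine ⟨_, key (-1) (by norm_num) (by linarith) ?_⟩
      by_contra hh; push Not at hh; nlinarith
  · have hroot : ∃ μ : ℝ, |μ| ≤ 1 ∧ μ ^ 2 - (A 0 0 + A 1 1) * μ + 1 = 0 := by
      have hD := Real.sq_sqrt (sub_nonneg.2 ht)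
      generalize Real.sqrt ((A 0 0 + A 1 1) ^ 2 - 4) = D at hD
      generalize A 0 0 + A 1 1 = t at *
      have hprod : ((t + D) / 2) * ((t - D) / 2) = 1 := by linear_combination -(1 / 4 : ℝ) * hD
      by_cases h : |(t + D) / 2| ≤ 1
      · exact ⟨_, h, by linear_combination (1 / 4 : ℝ) * hD⟩
      · refine ⟨(t - D) / 2, ?_, by linear_combination (1 / 4 : ℝ) * hD⟩
        push Not at h
        have h2 := congrArg abs hprod
        rw [abs_mul, abs_one] at h2
        by_contra h3
        push Not at h3
        nlinarith
    obtain ⟨μ, hμ, hr⟩ := hroot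
    have hev : ∃ v : Fin 2 → ℝ, v ≠ 0 ∧ (A : Matrix (Fin 2) (Fin 2) ℝ).mulVec v = μ • v := by
      by_cases h1 : A 0 1 = 0 ∧ μ - A 0 0 = 0
      · by_cases h2 : μ - A 1 1 = 0 ∧ A 1 0 = 0
        · refine ⟨![1, 0], by intro h; have := congrFun h 0; simp at this, ?_⟩
          funext i; fin_cases i <;> simp [Matrix.mulVec, dotProduct, Fin.sum_univ_two, h2.2]
          linarith
        · refine ⟨![μ - A 1 1, A 1 0], ?_, ?_⟩
          · intro h; apply h2
            exact ⟨by simpa using congrFun h 0, by simpa using congrFun h 1⟩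
          · funext i; fin_cases i <;> simp [Matrix.mulVec, dotProduct, Fin.sum_univ_two]
            · linear_combination -hr - hdet
            · ring
      · refine ⟨![A 0 1, μ - A 0 0], ?_, ?_⟩
        · intro h; apply h1
          exact ⟨by simpa using congrFun h 0, by simpa using congrFun h 1⟩
        · funext i; fin_cases i <;> simp [Matrix.mulVec, dotProduct, Fin.sum_univ_two]
          · ring
          · linear_combination -hr - hdet
    obtain ⟨v, hv, hAv⟩ := hev
    refine ⟨vv v, vv_cone v, ?_, μ ^ 2, (sq_le_one_iff_abs_le_one μ).2 hμ, ?_⟩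
    · intro h
      apply hv
      have h1 := congrArg (fun p => p.1) h
      have h2 := congrArg (fun p => p.2.2) h
      simp [vv] at h1 h2
      funext i; fin_cases i <;> simp [h1, h2]
    · rw [act_vv, hAv, vv_smul]

theorem act_cone (A : SL2) {P : Tri} (h : Cone P) : Cone (act A P) := by
  have h1 : 0 ≤ Bf P (vv ![-A 0 1, A 0 0]) := h.nonneg_Bf (vv_cone _)
  have h2 : 0 ≤ Bf P (vv ![-A 1 1, A 1 0]) := h.nonneg_Bf (vv_cone _)
  have h3 := Bf_act A P P
  refine ⟨?_, ?_, ?_⟩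
  · simp [Bf, vv] at h1; simp only [act]; linarith
  · simp [Bf, vv] at h2; simp only [act]; linarith
  · have := h.2.2
    simp only [Bf] at h3
    nlinarith

theorem act_ne_zero (A : SL2) {P : Tri} (h : P ≠ 0) : act A P ≠ 0 := by
  intro h0
  apply h
  rw [← act_inv_act A P, h0]
  apply tri_ext <;> simp [act]

theorem cone_Bf_zero {P Q : Tri} (hP : Cone P) (hP0 : P ≠ 0) (hQ : Cone Q) (hQ0 : Q ≠ 0) (h : Bf P Q = 0) :
    ∃ c : ℝ, Q = c • P := by
  have hz : ∀ R : Tri, Cone R → R ≠ 0 → R.1 = 0 → R.2.1 = 0 ∧ 0 < R.2.2 := by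
    intro R hR hR0 h1
    have := hR.2.2
    rw [h1, zero_mul] at this
    have h3 : R.2.1 = 0 := by nlinarith
    refine ⟨h3, lt_of_le_of_ne hR.2.1 ?_⟩
    intro h4; exact hR0 (cone_zero hR h1 h4.symm)
  have hz1 := hz P hP hP0
  have hz2 := hz Q hQ hQ0
  obtain ⟨p, q, r⟩ := P
  obtain ⟨p', q', r'⟩ := Q
  obtain ⟨a1, a2, a3⟩ := hP
  obtain ⟨b1, b2, b3⟩ := hQ
  simp only [Bf] at *
  have e1 : p * r' = r * p' := by
    have : (p * r' - r * p') ^ 2 ≤ 0 := by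
      have h4 : (q * q') ^ 2 ≤ (p * r) * (p' * r') := by
        rw [mul_pow]; exact mul_le_mul a3 b3 (sq_nonneg _) (by positivity)
      have h5 : p * r' + r * p' = 2 * (q * q') := by linarith
      have h6 : (p * r' - r * p') ^ 2 = (p * r' + r * p') ^ 2 - 4 * ((p * r) * (p' * r')) := by ring
      rw [h6, h5]; nlinarith
    nlinarith
  have e2 : q * q' = r * p' := by linarith
  rcases eq_or_lt_of_le a1 with hp | hp
  · obtain ⟨hq, hr⟩ := hz1 hp.symm
    subst hp hq
    have hp' : p' = 0 := by
      have : r * p' = 0 := by linarith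
      rcases mul_eq_zero.1 this with h | h
      · linarith
      · exact h
    obtain ⟨hq', hr'⟩ := hz2 hp'
    refine ⟨r' / r, ?_⟩
    apply tri_ext <;> simp [hp', hq']
    field_simp
  · refine ⟨p' / p, ?_⟩
    have hr' : r' = r * p' / p := by field_simp; linarith
    have hq' : q' = q * p' / p := by
      have : (p * q' - q * p') ^ 2 ≤ 0 := by
        have h7 : p ^ 2 * q' ^ 2 ≤ p * p' * (r * p') := by
          have := mul_le_mul_of_nonneg_left b3 (sq_nonneg p)
          calc p ^ 2 * q' ^ 2 ≤ p ^ 2 * (p' * r') := this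
            _ = p * p' * (p * r') := by ring
            _ = _ := by rw [e1]
        have h8 : q ^ 2 * p' ^ 2 ≤ p * p' * (r * p') := by
          calc q ^ 2 * p' ^ 2 ≤ (p * r) * p' ^ 2 := mul_le_mul_of_nonneg_right a3 (sq_nonneg _)
            _ = _ := by ring
        have h9 : (p * q' - q * p') ^ 2 = p ^ 2 * q' ^ 2 - 2 * (p * p') * (q * q') + q ^ 2 * p' ^ 2 := by ring
        rw [h9, e2]; linarith
      have : p * q' - q * p' = 0 := by nlinarith
      field_simp; linarith
    apply tri_ext
    · simp; field_simp
    · simp [hq']; ring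
    · simp [hr']; ring

theorem Fx_s_pos {A : SL2} {P : Tri} {s : ℝ} (hc : Cone P) (h0 : P ≠ 0) (h : act A P = s • P) : 0 < s := by
  refine cone_scale_pos hc h0 ?_ ?_
  · rw [← h]; exact act_cone A hc
  · rw [← h]; exact act_ne_zero A h0

theorem Fx_unique {A : SL2} (hA : A ≠ 1) (hA' : A ≠ -1) {P Q : Tri} (hP : Fx A P) (hQ : Fx A Q) :
    ∃ c : ℝ, 0 < c ∧ Q = c • P := by
  suffices h : ∃ c : ℝ, Q = c • P by
    obtain ⟨c, rfl⟩ := h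
    exact ⟨c, cone_scale_pos hP.1 hP.2.1 hQ.1 hQ.2.1, rfl⟩
  obtain ⟨hcP, hP0, s, hs, hAP⟩ := hP
  obtain ⟨hcQ, hQ0, s', hs', hAQ⟩ := hQ
  rcases eq_or_lt_of_le (hcP.nonneg_Bf hcQ) with hB | hB
  · exact cone_Bf_zero hcP hP0 hcQ hQ0 hB.symm
  · have p1 := Fx_s_pos hcP hP0 hAP
    have p2 := Fx_s_pos hcQ hQ0 hAQ
    have h1 := Bf_act A P Q
    rw [hAP, hAQ, Bf_smul, Bf_smul'] at h1
    have h2 : s * s' = 1 := by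
      have : (s * s' - 1) * Bf P Q = 0 := by linear_combination h1
      rcases mul_eq_zero.1 this with h | h
      · linarith
      · linarith
    have e1 : s = 1 := by nlinarith
    have e2 : s' = 1 := by nlinarith
    rw [e1, one_smul] at hAP
    rw [e2, one_smul] at hAQ
    have hdet := sl_det A
    have eqs : ∀ R : Tri, act A R = R → (A 0 0 - A 1 1) * R.1 + 2 * A 0 1 * R.2.1 = 0 ∧
        A 0 1 * R.2.2 + A 1 0 * R.1 = 0 ∧ 2 * A 1 0 * R.2.1 = (A 0 0 - A 1 1) * R.2.2 := by
      intro R hR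
      have r1 := congrArg (fun p => p.1) hR
      have r2 := congrArg (fun p => p.2.1) hR
      have r3 := congrArg (fun p => p.2.2) hR
      simp only [act] at r1 r2 r3
      refine ⟨?_, ?_, ?_⟩
      · linear_combination A 1 1 * r1 - A 0 1 * r2 - (A 0 0 * R.1 + A 0 1 * R.2.1) * hdet
      · linear_combination -A 1 0 * r1 + A 0 0 * r2 - (A 0 0 * R.2.1 + A 0 1 * R.2.2) * hdet
      · linear_combination -A 1 0 * r2 + A 0 0 * r3 - (A 1 0 * R.2.1 + A 1 1 * R.2.2) * hdet
    obtain ⟨x1, x2, x3⟩ := eqs P hAP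
    obtain ⟨y1, y2, y3⟩ := eqs Q hAQ
    have ker : ∀ R S : Tri, ∀ i : Tri, R ≠ 0 → (∃ k : ℝ, R = k • i) → (∃ k : ℝ, S = k • i) → ∃ c : ℝ, S = c • R := by
      rintro R S i hR ⟨k, rfl⟩ ⟨m, rfl⟩
      have hk : k ≠ 0 := by rintro rfl; simp at hR
      exact ⟨m / k, by rw [smul_smul, div_mul_cancel₀ _ hk]⟩
    have par : ∀ R : Tri, ((A 0 0 - A 1 1) * R.1 + 2 * A 0 1 * R.2.1 = 0 ∧
        A 0 1 * R.2.2 + A 1 0 * R.1 = 0 ∧ 2 * A 1 0 * R.2.1 = (A 0 0 - A 1 1) * R.2.2) →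
        ∃ k : ℝ, R = k • (-2 * A 0 1, A 0 0 - A 1 1, 2 * A 1 0) := by
      rintro R ⟨z1, z2, z3⟩
      by_cases hc : A 1 0 = 0
      · by_cases hb : A 0 1 = 0
        · by_cases ha : A 0 0 - A 1 1 = 0
          · exfalso
            rw [hb, hc] at hdet
            have : (A 0 0 - 1) * (A 0 0 + 1) = 0 := by
              have : A 1 1 = A 0 0 := by linarith
              rw [this] at hdet; linarith
            rcases mul_eq_zero.1 this with h | h
            · apply hA
              ext i k; fin_cases i <;> fin_cases k <;> simp [hb, hc] <;> linarith
            · apply hA'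
              ext i k; fin_cases i <;> fin_cases k <;> simp [hb, hc] <;> linarith
          · refine ⟨R.2.1 / (A 0 0 - A 1 1), ?_⟩
            simp only [hb, hc] at z1 z2 z3 ⊢
            apply tri_ext <;> simp
            · simp [ha] at z1; exact z1
            · field_simp
            · simp [ha] at z3; exact z3
        · refine ⟨R.1 / (-2 * A 0 1), ?_⟩
          apply tri_ext <;> simp
          · field_simp
          · field_simp; linarith
          · field_simp; linarith
      · refine ⟨R.2.2 / (2 * A 1 0), ?_⟩
        apply tri_ext <;> simp
        · field_simp; linarith
        · field_simp; linarith
        · field_simp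
    exact ker P Q _ hP0 (par P (eqs P hAP)) (par Q (eqs Q hAQ))

theorem mk_one_ne {A : SL2} : (QuotientGroup.mk A : PSL2) ≠ 1 ↔ A ≠ 1 ∧ A ≠ -1 := by
  have : (1 : PSL2) = QuotientGroup.mk 1 := rfl
  rw [this, Ne, mk_eq_mk_iff, not_or]

theorem one_mem_CS (M : SL2) : (1 : PSL2) ∈ CS M := by
  show (QuotientGroup.mk 1 : PSL2) ∈ CS M
  rw [mem_CS]
  obtain ⟨w, hw⟩ := posOf_nonempty M
  exact ⟨Pz w, Fx_of_fixed (one_smul _ _), le_of_lt hw⟩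

theorem compl_OS (M : SL2) : (OS M)ᶜ = CS (M * Sw) := by
  ext h
  obtain ⟨A, rfl⟩ := QuotientGroup.mk_surjective h
  by_cases h1 : (QuotientGroup.mk A : PSL2) = 1
  · rw [h1]
    exact ⟨fun _ => one_mem_CS _, fun _ h2 => h2.1 rfl⟩
  · have h1' := mk_one_ne.1 h1
    obtain ⟨P, hP⟩ := exists_Fx A
    rw [Set.mem_compl_iff, mem_OS, mem_CS]
    constructor
    · intro h2
      refine ⟨P, hP, ?_⟩
      rw [sd_Sw]
      by_contra h3
      exact h2 ⟨h1, P, hP, by linarith⟩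
    · rintro ⟨Q, hQ, hs⟩ ⟨-, R, hR, hs'⟩
      obtain ⟨c, hc, rfl⟩ := Fx_unique h1'.1 h1'.2 hQ hR
      rw [sd_Sw] at hs
      rw [sd_smul] at hs'
      nlinarith

theorem compl_CS (M : SL2) : (CS M)ᶜ = OS (M * Sw) := by
  rw [← compl_compl (OS (M * Sw)), compl_OS]
  congr 1
  ext h
  have e : ∀ P, sd (M * Sw * Sw) P = sd M P := fun P => by rw [sd_Sw, sd_Sw, neg_neg]
  simp only [CS, e]

theorem OS_subset_CS (M : SL2) : OS M ⊆ CS M := by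
  rintro h ⟨-, A, hA, P, hP, hs⟩
  exact ⟨A, hA, P, hP, hs.le⟩

theorem Fx_conj (G : SL2) {A : SL2} {P : Tri} (h : Fx A P) : Fx (G * A * G⁻¹) (act G P) := by
  obtain ⟨h1, h2, s, hs, h3⟩ := h
  refine ⟨act_cone G h1, act_ne_zero G h2, s, hs, ?_⟩
  rw [act_mul, act_mul, act_inv_act, h3, act_smul]

/-! ### Topology of the half-spaces -/

theorem mem_CS_conj (G : SL2) {M : SL2} {h : PSL2} (hh : h ∈ CS M) :
    (QuotientGroup.mk G : PSL2) * h * (QuotientGroup.mk G : PSL2)⁻¹ ∈ CS (G * M) := by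
  obtain ⟨A, rfl, P, hP, hs⟩ := hh
  exact ⟨G * A * G⁻¹, rfl, act G P, Fx_conj G hP, by rwa [sd_mul_act]⟩

theorem mem_OS_conj (G : SL2) {M : SL2} {h : PSL2} (hh : h ∈ OS M) :
    (QuotientGroup.mk G : PSL2) * h * (QuotientGroup.mk G : PSL2)⁻¹ ∈ OS (G * M) := by
  obtain ⟨h1, A, rfl, P, hP, hs⟩ := hh
  refine ⟨?_, G * A * G⁻¹, rfl, act G P, Fx_conj G hP, by rwa [sd_mul_act]⟩
  rwa [Ne, conj_eq_one_iff]

instance sl2TopGroup : IsTopologicalGroup SL2 :=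
  (inferInstance : @IsTopologicalGroup SL2 Matrix.SpecialLinearGroup.instTopologicalSpace _)

theorem continuous_entry (i k : Fin 2) : Continuous (fun A : SL2 => A i k) := by
  have h : Continuous (fun A : SL2 => (A : Matrix (Fin 2) (Fin 2) ℝ)) := continuous_induced_dom
  exact (continuous_apply k).comp ((continuous_apply i).comp h)

theorem continuous_act_joint : Continuous (fun x : SL2 × Tri => act x.1 x.2) := by
  have h00 := (continuous_entry 0 0).comp (continuous_fst (X := SL2) (Y := Tri))
  have h01 := (continuous_entry 0 1).comp (continuous_fst (X := SL2) (Y := Tri))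
  have h10 := (continuous_entry 1 0).comp (continuous_fst (X := SL2) (Y := Tri))
  have h11 := (continuous_entry 1 1).comp (continuous_fst (X := SL2) (Y := Tri))
  simp only [Function.comp_def] at h00 h01 h10 h11
  unfold act
  fun_prop

/-- A compact base of the cone. -/
def KB : Set Tri := {P | Cone P ∧ P.1 + P.2.2 = 1}

theorem KB_compact : IsCompact KB := by
  have hK : IsCompact ((Set.Icc (0 : ℝ) 1) ×ˢ ((Set.Icc (-1 : ℝ) 1) ×ˢ (Set.Icc (0 : ℝ) 1))) :=
    isCompact_Icc.prod (isCompact_Icc.prod isCompact_Icc)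
  refine hK.of_isClosed_subset ?_ ?_
  · have h1 : IsClosed {P : Tri | 0 ≤ P.1} := isClosed_le continuous_const continuous_fst
    have h2 : IsClosed {P : Tri | 0 ≤ P.2.2} := isClosed_le continuous_const (by fun_prop)
    have h3 : IsClosed {P : Tri | P.2.1 ^ 2 ≤ P.1 * P.2.2} := isClosed_le (by fun_prop) (by fun_prop)
    have h4 : IsClosed {P : Tri | P.1 + P.2.2 = 1} := isClosed_eq (by fun_prop) (by fun_prop)
    have := (h1.inter (h2.inter h3)).inter h4
    exact this
  · rintro ⟨p, q, r⟩ ⟨⟨h1, h2, h3⟩, h4⟩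
    simp only at h1 h2 h3 h4
    have : q ^ 2 ≤ 1 := by nlinarith
    refine ⟨⟨h1, by simp only; linarith⟩, ⟨?_, ?_⟩, ⟨h2, by simp only; linarith⟩⟩
    · simp only; nlinarith
    · simp only; nlinarith

theorem CS_closed (M : SL2) : IsClosed (CS M) := by
  have hq : IsQuotientMap (QuotientGroup.mk : SL2 → PSL2) := isQuotientMap_quotient_mk'
  rw [← hq.isClosed_preimage]
  have hcomp : CompactSpace ↥(KB ×ˢ (Set.Icc (0 : ℝ) 1)) :=
    isCompact_iff_compactSpace.1 (KB_compact.prod isCompact_Icc)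
  let C : Set (SL2 × ↥(KB ×ˢ (Set.Icc (0 : ℝ) 1))) :=
    {x | act x.1 x.2.1.1 = x.2.1.2 • x.2.1.1 ∧ 0 ≤ sd M x.2.1.1}
  have hC : IsClosed C := by
    have c1 : Continuous (fun x : SL2 × ↥(KB ×ˢ (Set.Icc (0 : ℝ) 1)) => x.2.1.1) := by fun_prop
    have c2 : Continuous (fun x : SL2 × ↥(KB ×ˢ (Set.Icc (0 : ℝ) 1)) => x.2.1.2) := by fun_prop
    have a1 : IsClosed {x : SL2 × ↥(KB ×ˢ (Set.Icc (0 : ℝ) 1)) | act x.1 x.2.1.1 = x.2.1.2 • x.2.1.1} :=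
      isClosed_eq (continuous_act_joint.comp (continuous_fst.prodMk c1)) (c2.smul c1)
    have a2 : IsClosed {x : SL2 × ↥(KB ×ˢ (Set.Icc (0 : ℝ) 1)) | 0 ≤ sd M x.2.1.1} :=
      isClosed_le continuous_const ((continuous_sd M).comp c1)
    exact a1.inter a2
  have himg : (QuotientGroup.mk : SL2 → PSL2) ⁻¹' CS M = Prod.fst '' C := by
    ext A
    rw [Set.mem_preimage, mem_CS]
    constructor
    · rintro ⟨P, ⟨hc, h0, s, hs, hA⟩, hsd⟩
      have hs0 := Fx_s_pos hc h0 hA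
      have htr : 0 < P.1 + P.2.2 := by
        rcases lt_or_eq_of_le (add_nonneg hc.1 hc.2.1) with h | h
        · exact h
        · exfalso
          apply h0
          have e1 := hc.1
          have e2 := hc.2.1
          exact cone_zero hc (by linarith) (by linarith)
      have hk : 0 < (P.1 + P.2.2)⁻¹ := inv_pos.2 htr
      have hk1 : (P.1 + P.2.2)⁻¹ * (P.1 + P.2.2) = 1 := inv_mul_cancel₀ htr.ne'
      generalize (P.1 + P.2.2)⁻¹ = k at hk hk1
      have hKB : k • P ∈ KB := by
        refine ⟨⟨?_, ?_, ?_⟩, ?_⟩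
        · exact mul_nonneg hk.le hc.1
        · exact mul_nonneg hk.le hc.2.1
        · simp only [Prod.smul_fst, Prod.smul_snd, smul_eq_mul]
          have := mul_le_mul_of_nonneg_left hc.2.2 (sq_nonneg k)
          nlinarith
        · simp only [Prod.smul_fst, Prod.smul_snd, smul_eq_mul]; linarith
      refine ⟨(A, ⟨(k • P, s), hKB, hs0.le, hs⟩), ⟨?_, ?_⟩, rfl⟩
      · simp only; rw [act_smul, hA, smul_comm]
      · simp only; rw [sd_smul]; positivity
    · rintro ⟨⟨A', ⟨⟨P, s⟩, ⟨hP, hP1⟩, hs⟩⟩, ⟨h1, h2⟩, rfl⟩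
      refine ⟨P, ⟨hP, ?_, s, hs.2, h1⟩, h2⟩
      rintro rfl
      simp at hP1
  rw [himg]
  exact isClosedMap_fst_of_compactSpace _ hC

theorem OS_open (M : SL2) : IsOpen (OS M) := by
  rw [← isClosed_compl_iff, compl_OS]; exact CS_closed _

theorem mk_continuous : Continuous (QuotientGroup.mk : SL2 → PSL2) := continuous_quotient_mk'

theorem continuous_sl2 {X : Type*} [TopologicalSpace X] {f : X → SL2}
    (h : ∀ i k, Continuous fun x => f x i k) : Continuous f := by
  rw [continuous_induced_rng]
  exact continuous_pi fun i => continuous_pi fun k => h i k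

/-- The hyperbolic translation pushing across the line `iℝ`. -/
def hyp (e : ℝ) : SL2 := ⟨!![Real.cosh e, Real.sinh e; Real.sinh e, Real.cosh e], by
  rw [Matrix.det_fin_two]; simp; have := Real.cosh_sq e; linarith⟩

/-- Rotations. -/
def rot (e : ℝ) : SL2 := ⟨!![Real.cos e, -Real.sin e; Real.sin e, Real.cos e], by
  rw [Matrix.det_fin_two]; simp; have := Real.cos_sq_add_sin_sq e; linarith⟩

theorem continuous_hyp : Continuous hyp := by
  apply continuous_sl2
  intro i k
  fin_cases i <;> fin_cases k <;> simp [hyp] <;> fun_prop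

theorem continuous_rot : Continuous rot := by
  apply continuous_sl2
  intro i k
  fin_cases i <;> fin_cases k <;> simp [rot] <;> fun_prop

theorem hyp_zero : hyp 0 = 1 := by
  ext i k; fin_cases i <;> fin_cases k <;> simp [hyp]

theorem rot_zero : rot 0 = 1 := by
  ext i k; fin_cases i <;> fin_cases k <;> simp [rot]

theorem CS_subset_closure (M : SL2) : CS M ⊆ closure (OS M) := by
  intro h hh
  obtain ⟨A, rfl⟩ := QuotientGroup.mk_surjective h
  by_cases h1 : (QuotientGroup.mk A : PSL2) = 1
  · rw [h1]
    obtain ⟨w, hw⟩ := posOf_nonempty M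
    obtain ⟨N, hN⟩ : ∃ N : SL2, N • UpperHalfPlane.I = w := MulAction.exists_smul_eq SL2 _ _
    have hc : Continuous fun e => (QuotientGroup.mk (N * rot e * N⁻¹) : PSL2) :=
      mk_continuous.comp ((continuous_const.mul continuous_rot).mul continuous_const)
    have ht := hc.tendsto 0
    simp only [rot_zero, mul_one, mul_inv_cancel] at ht
    refine mem_closure_of_tendsto (ht.mono_left (nhdsWithin_le_nhds (s := Set.Ioi 0))) ?_
    have : ∀ᶠ e : ℝ in 𝓝[>] 0, e < Real.pi := nhdsWithin_le_nhds (Iio_mem_nhds Real.pi_pos)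
    filter_upwards [self_mem_nhdsWithin, this] with e he he'
    have hs := Real.sin_pos_of_pos_of_lt_pi he he'
    rw [mem_OS]
    refine ⟨?_, Pz w, Fx_of_fixed ?_, hw⟩
    · show (QuotientGroup.mk N : PSL2) * QuotientGroup.mk (rot e) * (QuotientGroup.mk N)⁻¹ ≠ 1
      rw [Ne, conj_eq_one_iff, ← Ne, mk_one_ne]
      constructor
      · intro h2
        have := congrArg (fun B : SL2 => B 1 0) h2
        simp [rot] at this; linarith
      · intro h2
        have := congrArg (fun B : SL2 => B 1 0) h2
        simp [rot] at this; linarith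
    · rw [← hN, mul_smul, mul_smul, inv_smul_smul]
      congr 1
      apply Pz_inj
      rw [Pz_act]
      have := Real.cos_sq_add_sin_sq e
      apply tri_ext <;> simp [act, rot, Pz]
      linarith
  · obtain ⟨P, hP, hs⟩ := mem_CS.1 hh
    have hc : Continuous fun e => (QuotientGroup.mk ((M * hyp e * M⁻¹) * A * (M * hyp e * M⁻¹)⁻¹) : PSL2) := by
      have c1 : Continuous fun e => M * hyp e * M⁻¹ := (continuous_const.mul continuous_hyp).mul continuous_const
      exact mk_continuous.comp ((c1.mul continuous_const).mul c1.inv)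
    have ht := hc.tendsto 0
    simp only [hyp_zero, mul_one, mul_inv_cancel, one_mul, inv_one] at ht
    refine mem_closure_of_tendsto (ht.mono_left (nhdsWithin_le_nhds (s := Set.Ioi 0))) ?_
    filter_upwards [self_mem_nhdsWithin] with e he
    rw [mem_OS]
    refine ⟨?_, _, Fx_conj _ hP, ?_⟩
    · intro h2
      apply h1
      exact conj_eq_one_iff.1 (show (QuotientGroup.mk (M * hyp e * M⁻¹) : PSL2) * QuotientGroup.mk A * (QuotientGroup.mk (M * hyp e * M⁻¹))⁻¹ = 1 from h2)
    · rw [sd] at hs ⊢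
      have hcQ := act_cone M⁻¹ hP.1
      have hQ0 := act_ne_zero M⁻¹ hP.2.1
      rw [act_mul, act_mul, act_inv_act]
      generalize act M⁻¹ P = Q at *
      have he' : 0 < Real.sinh e := Real.sinh_pos_iff.2 he
      have hch := Real.cosh_pos e
      have htr : 0 < Q.1 + Q.2.2 := by
        rcases lt_or_eq_of_le (add_nonneg hcQ.1 hcQ.2.1) with h | h
        · exact h
        · exfalso
          apply hQ0
          have e1 := hcQ.1
          have e2 := hcQ.2.1
          exact cone_zero hcQ (by linarith) (by linarith)
      simp only [act, hyp]
      simp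
      have h5 : 0 < Real.cosh e * Real.sinh e * (Q.1 + Q.2.2) := by positivity
      have h6 : 0 ≤ (Real.cosh e * Real.cosh e + Real.sinh e * Real.sinh e) * Q.2.1 := by positivity
      linarith

/-! ### Hyperbolic geometry -/

theorem Bf_Pz_self (z : ℍ) : Bf (Pz z) (Pz z) = 2 := by
  rw [← cosh_Bf]; simp

theorem Bf_Pz_ge (z w : ℍ) : 2 ≤ Bf (Pz z) (Pz w) := by
  rw [← cosh_Bf]; linarith [Real.one_le_cosh (dist z w)]

theorem dist_le_of_Bf {z w z' w' : ℍ} (h : Bf (Pz z) (Pz w) ≤ Bf (Pz z') (Pz w')) : dist z w ≤ dist z' w' := by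
  rw [← cosh_Bf, ← cosh_Bf] at h
  have h' : Real.cosh (dist z w) ≤ Real.cosh (dist z' w') := by linarith
  rw [Real.cosh_le_cosh, abs_of_nonneg dist_nonneg, abs_of_nonneg dist_nonneg] at h'
  exact h'

theorem exists_btw (x y : ℍ) {α β : ℝ} (ha : 0 ≤ α) (hb : 0 ≤ β) (hab : 0 < α + β) :
    ∃ m : ℍ, ∃ c : ℝ, 0 < c ∧ α • Pz x + β • Pz y = c • Pz m ∧ dist x m + dist m y = dist x y := by
  have hxx := Bf_Pz_self x
  have hyy := Bf_Pz_self y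
  have hxy := cosh_Bf x y
  have hge := Bf_Pz_ge x y
  have px := Pz_pos x
  have py := Pz_pos y
  have hpos : 0 < α ^ 2 + β ^ 2 + α * β * Bf (Pz x) (Pz y) := by
    have : 0 ≤ α * β := mul_nonneg ha hb
    nlinarith
  obtain ⟨m, c, hc, hm⟩ : ∃ m : ℍ, ∃ c : ℝ, 0 < c ∧ α • Pz x + β • Pz y = c • Pz m := by
    apply exists_Pz
    · simp only [Prod.fst_add, Prod.smul_fst, smul_eq_mul]
      rcases eq_or_lt_of_le ha with h | h
      · have : 0 < β := by linarith
        have := mul_pos this py.1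
        have := mul_nonneg ha px.1.le
        linarith
      · have := mul_pos h px.1
        have := mul_nonneg hb py.1.le
        linarith
    · simp only [Prod.fst_add, Prod.snd_add, Prod.smul_fst, Prod.smul_snd, smul_eq_mul]
      have : (α * (Pz x).1 + β * (Pz y).1) * (α * (Pz x).2.2 + β * (Pz y).2.2) - (α * (Pz x).2.1 + β * (Pz y).2.1) ^ 2
        = α ^ 2 + β ^ 2 + α * β * Bf (Pz x) (Pz y) := by
        simp only [Bf]
        linear_combination α ^ 2 * px.2.2 + β ^ 2 * py.2.2
      rw [this]; exact hpos
  refine ⟨m, c, hc, hm, ?_⟩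
  have e1 : c * Bf (Pz x) (Pz m) = 2 * α + β * Bf (Pz x) (Pz y) := by
    rw [← Bf_smul, ← hm, Bf_add, Bf_smul, Bf_smul, hxx]; ring
  have e2 : c * Bf (Pz m) (Pz y) = α * Bf (Pz x) (Pz y) + 2 * β := by
    rw [← Bf_smul', ← hm, Bf_add', Bf_smul', Bf_smul', hyy]; ring
  have e3 : c ^ 2 = α ^ 2 + β ^ 2 + α * β * Bf (Pz x) (Pz y) := by
    have : c * (c * Bf (Pz m) (Pz m)) = 2 * (α ^ 2 + β ^ 2 + α * β * Bf (Pz x) (Pz y)) := by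
      rw [← Bf_smul, ← Bf_smul', ← hm]
      simp only [Bf_add, Bf_add', Bf_smul, Bf_smul', hxx, hyy, Bf_comm (Pz y) (Pz x)]
      ring
    rw [Bf_Pz_self] at this
    linarith
  rw [← cosh_Bf] at e1 e2
  rw [← hxy] at e1 e2 e3
  have s1 := Real.cosh_sq (dist x m)
  have s2 := Real.cosh_sq (dist m y)
  have s3 := Real.cosh_sq (dist x y)
  have t1 : 0 ≤ Real.sinh (dist x m) := Real.sinh_nonneg_iff.2 dist_nonneg
  have t2 : 0 ≤ Real.sinh (dist m y) := Real.sinh_nonneg_iff.2 dist_nonneg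
  have t3 : 0 ≤ Real.sinh (dist x y) := Real.sinh_nonneg_iff.2 dist_nonneg
  have hadd := Real.cosh_add (dist x m) (dist m y)
  have hres : Real.cosh (dist x m + dist m y) = Real.cosh (dist x y) := by
    rw [hadd]
    generalize Real.cosh (dist x m) = C1 at *
    generalize Real.cosh (dist m y) = C2 at *
    generalize Real.cosh (dist x y) = C at *
    generalize Real.sinh (dist x m) = S1 at *
    generalize Real.sinh (dist m y) = S2 at *
    generalize Real.sinh (dist x y) = S at *
    have f1 : c * C1 = α + β * C := by linarith
    have f2 : c * C2 = α * C + β := by linarith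
    have g1 : c * S1 = β * S := by
      have : (c * S1) ^ 2 = (β * S) ^ 2 := by
        have : (c * C1) ^ 2 = (α + β * C) ^ 2 := by rw [f1]
        linear_combination this - c ^ 2 * s1 - e3 + β ^ 2 * s3
      exact (pow_left_inj₀ (by positivity) (by positivity) two_ne_zero).1 this
    have g2 : c * S2 = α * S := by
      have : (c * S2) ^ 2 = (α * S) ^ 2 := by
        have : (c * C2) ^ 2 = (α * C + β) ^ 2 := by rw [f2]
        linear_combination this - c ^ 2 * s2 - e3 + α ^ 2 * s3
      exact (pow_left_inj₀ (by positivity) (by positivity) two_ne_zero).1 this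
    have : c ^ 2 * (C1 * C2 + S1 * S2) = c ^ 2 * C := by
      calc c ^ 2 * (C1 * C2 + S1 * S2) = (c * C1) * (c * C2) + (c * S1) * (c * S2) := by ring
        _ = (α + β * C) * (α * C + β) + (β * S) * (α * S) := by rw [f1, f2, g1, g2]
        _ = c ^ 2 * C := by rw [e3]; linear_combination (-α * β) * s3
    exact mul_left_cancel₀ (pow_ne_zero 2 hc.ne') this
  have h5 := le_antisymm (Real.cosh_le_cosh.1 hres.le) (Real.cosh_le_cosh.1 hres.ge)
  rwa [abs_of_nonneg (add_nonneg dist_nonneg dist_nonneg), abs_of_nonneg dist_nonneg] at h5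

theorem crossing {M : SL2} {p q : ℍ} (hp : sd M (Pz p) ≤ 0) (hq : 0 ≤ sd M (Pz q)) :
    ∃ m ∈ lineOf M, dist p m + dist m q = dist p q := by
  by_cases h : sd M (Pz p) = 0
  · exact ⟨p, h, by simp⟩
  · have hp' : sd M (Pz p) < 0 := lt_of_le_of_ne hp h
    obtain ⟨m, c, hc, hm, hd⟩ := exists_btw p q hq (neg_nonneg.2 hp) (by linarith)
    refine ⟨m, ?_, hd⟩
    have h1 : sd M (c • Pz m) = 0 := by
      rw [← hm, sd_add, sd_smul, sd_smul]; ring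
    rw [sd_smul] at h1
    exact (mul_eq_zero.1 h1).resolve_left hc.ne'

theorem Pz_psl (A : SL2) (z : ℍ) : Pz ((QuotientGroup.mk A : PSL2) • z) = act A (Pz z) := by
  rw [mk_smul, Pz_act]

theorem midpoint_ineq (g : PSL2) (x : ℍ) : ∃ m : ℍ, dist m (g • m) ≤ dist x (g • g • x) / 2 := by
  obtain ⟨A, rfl⟩ := QuotientGroup.mk_surjective g
  obtain ⟨m, c, hc, hm, -⟩ := exists_btw x ((QuotientGroup.mk A : PSL2) • x) zero_le_one zero_le_one (by norm_num)
  refine ⟨m, ?_⟩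
  rw [one_smul, one_smul] at hm
  have hm' : Pz ((QuotientGroup.mk A : PSL2) • x) + Pz ((QuotientGroup.mk A : PSL2) • (QuotientGroup.mk A : PSL2) • x)
      = c • Pz ((QuotientGroup.mk A : PSL2) • m) := by
    rw [Pz_psl A m, ← act_smul, ← hm, act_add, ← Pz_psl, ← Pz_psl]
  have hyz : dist ((QuotientGroup.mk A : PSL2) • x) ((QuotientGroup.mk A : PSL2) • (QuotientGroup.mk A : PSL2) • x) = dist x ((QuotientGroup.mk A : PSL2) • x) := psl_dist _ _ _
  generalize (QuotientGroup.mk A : PSL2) • m = m' at *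
  generalize (QuotientGroup.mk A : PSL2) • (QuotientGroup.mk A : PSL2) • x = z at *
  generalize (QuotientGroup.mk A : PSL2) • x = y at *
  have hB1 := cosh_Bf x y
  have hB2 := cosh_Bf y z
  have hB3 := cosh_Bf x z
  rw [hyz] at hB2
  have e1 : c * (c * Bf (Pz m) (Pz m)) = 4 + 4 * Real.cosh (dist x y) := by
    rw [← Bf_smul, ← Bf_smul', ← hm]
    simp only [Bf_add, Bf_add', Bf_Pz_self, Bf_comm (Pz y) (Pz x), ← hB1]; ring
  have e2 : c * (c * Bf (Pz m) (Pz m')) = 4 * Real.cosh (dist x y) + 2 * Real.cosh (dist x z) + 2 := by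
    rw [← Bf_smul, ← Bf_smul', ← hm, ← hm']
    simp only [Bf_add, Bf_add', Bf_Pz_self, ← hB1, ← hB2, ← hB3]; ring
  rw [Bf_Pz_self] at e1
  rw [← cosh_Bf] at e2
  have htri : dist x z / 2 ≤ dist x y := by
    have := dist_triangle x y z
    rw [hyz] at this; linarith
  have hH : Real.cosh (dist x z / 2) ≤ Real.cosh (dist x y) := by
    rw [Real.cosh_le_cosh, abs_of_nonneg (by positivity), abs_of_nonneg dist_nonneg]; exact htri
  have hE : Real.cosh (dist x z) = 2 * Real.cosh (dist x z / 2) ^ 2 - 1 := by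
    have := Real.cosh_two_mul (dist x z / 2)
    rw [show 2 * (dist x z / 2) = dist x z by ring] at this
    have h2 := Real.cosh_sq (dist x z / 2)
    linarith
  have hH1 := Real.one_le_cosh (dist x z / 2)
  have goal : Real.cosh (dist m m') ≤ Real.cosh (dist x z / 2) := by
    rw [hE] at e2
    generalize Real.cosh (dist x z / 2) = H at *
    generalize Real.cosh (dist x y) = C at *
    generalize Real.cosh (dist m m') = X at *
    have e1' : c ^ 2 = 2 + 2 * C := by linarith
    have e2' : c ^ 2 * X = 2 * C + 2 * H ^ 2 := by linarith
    have : c ^ 2 * X ≤ c ^ 2 * H := by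
      rw [e2', e1']; nlinarith
    exact le_of_mul_le_mul_left this (by positivity)
  rwa [Real.cosh_le_cosh, abs_of_nonneg dist_nonneg, abs_of_nonneg (by positivity)] at goal

theorem lemma_G {M : SL2} {h : PSL2} (hh : h ∈ OS M) {p : ℍ} (hp : sd M (Pz p) ≤ 0) :
    ∃ q ∈ lineOf M, dist p q ≤ dist (h • p) q := by
  obtain ⟨-, A, rfl, P, ⟨hc, h0, s, hs, hA⟩, hsd⟩ := hh
  have hs0 := Fx_s_pos hc h0 hA
  have px := Pz_pos p
  have hB := (Pz_cone p).nonneg_Bf hc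
  obtain ⟨q, c, hc', hq⟩ : ∃ q : ℍ, ∃ c : ℝ, 0 < c ∧ sd M P • Pz p + (-sd M (Pz p)) • P = c • Pz q := by
    have hb : 0 ≤ -sd M (Pz p) := by linarith
    generalize -sd M (Pz p) = β at hb
    generalize sd M P = α at hsd
    apply exists_Pz
    · simp only [Prod.fst_add, Prod.smul_fst, smul_eq_mul]
      have := mul_pos hsd px.1
      have := mul_nonneg hb hc.1
      linarith
    · simp only [Prod.fst_add, Prod.snd_add, Prod.smul_fst, Prod.smul_snd, smul_eq_mul]
      have h3 : (α * (Pz p).1 + β * P.1) * (α * (Pz p).2.2 + β * P.2.2) - (α * (Pz p).2.1 + β * P.2.1) ^ 2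
        = α ^ 2 + β ^ 2 * (P.1 * P.2.2 - P.2.1 ^ 2) + α * β * Bf (Pz p) P := by
        simp only [Bf]
        linear_combination α ^ 2 * px.2.2
      rw [h3]
      have h4 := hc.2.2
      have h5 : 0 ≤ β ^ 2 * (P.1 * P.2.2 - P.2.1 ^ 2) := mul_nonneg (sq_nonneg _) (by linarith)
      have h6 : 0 ≤ α * β * Bf (Pz p) P := by positivity
      have h7 : 0 < α ^ 2 := by positivity
      linarith
  refine ⟨q, ?_, ?_⟩
  · have h1 : sd M (c • Pz q) = 0 := by
      rw [← hq, sd_add, sd_smul, sd_smul]; ring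
    rw [sd_smul] at h1
    exact (mul_eq_zero.1 h1).resolve_left hc'.ne'
  · apply dist_le_of_Bf
    refine le_of_mul_le_mul_left ?_ hc'
    rw [← Bf_smul, ← Bf_smul, ← hq, Bf_add, Bf_add, Bf_smul, Bf_smul, Bf_smul, Bf_smul, Bf_Pz_self]
    have h1 := Bf_Pz_ge ((QuotientGroup.mk A : PSL2) • p) p
    have h2 : s * Bf (Pz ((QuotientGroup.mk A : PSL2) • p)) P = Bf (Pz p) P := by
      rw [← Bf_smul, ← hA, Pz_psl, Bf_act]
    have h3 : Bf (Pz p) P ≤ Bf (Pz ((QuotientGroup.mk A : PSL2) • p)) P := by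
      rw [← h2] at hB ⊢
      have : 0 ≤ Bf (Pz ((QuotientGroup.mk A : PSL2) • p)) P := nonneg_of_mul_nonneg_right hB hs0
      nlinarith
    have h4 := mul_le_mul_of_nonneg_left h1 hsd.le
    have h5 := mul_le_mul_of_nonneg_left h3 (neg_nonneg.2 hp)
    linarith

theorem exists_map (v w p q : Fin 2 → ℝ) (hD : v 0 * w 1 - v 1 * w 0 ≠ 0)
    (h : p 0 * q 1 - p 1 * q 0 = v 0 * w 1 - v 1 * w 0) :
    ∃ X : SL2, (X : Matrix (Fin 2) (Fin 2) ℝ).mulVec v = p ∧ (X : Matrix (Fin 2) (Fin 2) ℝ).mulVec w = q := by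
  obtain ⟨k, hk⟩ : ∃ k, k * (v 0 * w 1 - v 1 * w 0) = 1 := ⟨_, inv_mul_cancel₀ hD⟩
  refine ⟨⟨!![k * (p 0 * w 1 - q 0 * v 1), k * (-p 0 * w 0 + q 0 * v 0);
      k * (p 1 * w 1 - q 1 * v 1), k * (-p 1 * w 0 + q 1 * v 0)], ?_⟩, ?_, ?_⟩
  · rw [Matrix.det_fin_two]; simp
    linear_combination k ^ 2 * (v 0 * w 1 - v 1 * w 0) * h + (k * (v 0 * w 1 - v 1 * w 0) + 1) * hk
  · funext i; fin_cases i <;> simp [Matrix.mulVec, dotProduct, Fin.sum_univ_two]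
    · linear_combination p 0 * hk
    · linear_combination p 1 * hk
  · funext i; fin_cases i <;> simp [Matrix.mulVec, dotProduct, Fin.sum_univ_two]
    · linear_combination q 0 * hk
    · linear_combination q 1 * hk

theorem vv_ne_zero {v : Fin 2 → ℝ} (hv : v ≠ 0) : vv v ≠ 0 := by
  intro h
  apply hv
  have h1 := congrArg (fun p => p.1) h
  have h2 := congrArg (fun p => p.2.2) h
  simp [vv] at h1 h2
  funext i; fin_cases i <;> simp [h1, h2]

theorem Bf_vv_lt {M N G K : SL2} 
    (hid : ∀ ξ : OnePoint ℝ, ¬ (0 ≤ sd M (vv (bvec ξ)) ∧ 0 ≤ sd N (vv (bvec ξ))))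
    (hdis : ∀ X : SL2, ¬ ((QuotientGroup.mk (G⁻¹ * X) : PSL2) ∈ CS M ∧ (QuotientGroup.mk (K⁻¹ * X) : PSL2) ∈ CS N))
    {v w : Fin 2 → ℝ} (hv : v ≠ 0) (hw : w ≠ 0) (hMv : sd M (vv v) = 0) (hNw : sd N (vv w) = 0) :
    Bf (act G (vv v)) (act K (vv w)) < Bf (vv v) (vv w) := by
  have hD : v 0 * w 1 - v 1 * w 0 ≠ 0 := by
    intro hD
    have : Bf (vv v) (vv w) = 0 := by rw [Bf_vv, hD]; simp
    obtain ⟨c, hc⟩ := cone_Bf_zero (vv_cone v) (vv_ne_zero hv) (vv_cone w) (vv_ne_zero hw) this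
    have hc0 : 0 < c := cone_scale_pos (vv_cone v) (vv_ne_zero hv) (hc ▸ vv_cone w) (hc ▸ vv_ne_zero hw)
    obtain ⟨ξ, k, hk, rfl⟩ := exists_bvec hv
    apply hid ξ
    rw [hc, vv_smul, sd_smul, sd_smul] at hNw
    rw [vv_smul, sd_smul] at hMv
    have h2 : k ^ 2 ≠ 0 := pow_ne_zero 2 hk
    have h3 := (mul_eq_zero.1 hMv).resolve_left h2
    have h4 := (mul_eq_zero.1 ((mul_eq_zero.1 hNw).resolve_left hc0.ne')).resolve_left h2
    exact ⟨h3.ge, h4.ge⟩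
  by_contra hcon
  push Not at hcon
  rw [act_vv, act_vv, Bf_vv, Bf_vv] at hcon
  set p := (G : Matrix (Fin 2) (Fin 2) ℝ).mulVec v with hp
  set q := (K : Matrix (Fin 2) (Fin 2) ℝ).mulVec w with hq
  have hD2 : 0 < (v 0 * w 1 - v 1 * w 0) ^ 2 := by positivity
  have hE : p 0 * q 1 - p 1 * q 0 ≠ 0 := by
    intro h; rw [h] at hcon; nlinarith
  obtain ⟨μ, hμ⟩ : ∃ μ, μ = (v 0 * w 1 - v 1 * w 0) / (p 0 * q 1 - p 1 * q 0) := ⟨_, rfl⟩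
  have hμE : μ * (p 0 * q 1 - p 1 * q 0) = v 0 * w 1 - v 1 * w 0 := by
    rw [hμ, div_mul_cancel₀ _ hE]
  have hμ1 : μ ^ 2 ≤ 1 := by
    rw [hμ, div_pow, div_le_one (by positivity)]; exact hcon
  obtain ⟨X, hX1, hX2⟩ := exists_map v w (μ • p) q hD (by simp; linear_combination hμE)
  apply hdis X
  have hinv : ∀ (B : SL2) (u : Fin 2 → ℝ), ((B⁻¹ : SL2) : Matrix (Fin 2) (Fin 2) ℝ).mulVec ((B : Matrix (Fin 2) (Fin 2) ℝ).mulVec u) = u := by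
    intro B u
    rw [Matrix.mulVec_mulVec, ← Matrix.SpecialLinearGroup.coe_mul, inv_mul_cancel]; simp
  rw [mem_CS, mem_CS]
  constructor
  · refine ⟨vv v, ⟨vv_cone v, vv_ne_zero hv, μ ^ 2, hμ1, ?_⟩, hMv.ge⟩
    rw [act_vv, Matrix.SpecialLinearGroup.coe_mul, ← Matrix.mulVec_mulVec, hX1, Matrix.mulVec_smul, hp, hinv, vv_smul]
  · refine ⟨vv w, ⟨vv_cone w, vv_ne_zero hw, 1, le_refl _, ?_⟩, hNw.ge⟩
    rw [act_vv, Matrix.SpecialLinearGroup.coe_mul, ← Matrix.mulVec_mulVec, hX2, hq, hinv, one_smul]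

theorem line_param {M : SL2} {y : ℍ} (hy : y ∈ lineOf M) :
    ∃ t : ℝ, 0 < t ∧ Pz y = t • act M (vv ![1, 0]) + t⁻¹ • act M (vv ![0, 1]) := by
  change sd M (Pz y) = 0 at hy
  rw [sd, ← Pz_act] at hy
  obtain ⟨h1, h2, h3⟩ := Pz_pos (M⁻¹ • y)
  refine ⟨(Pz (M⁻¹ • y)).1, h1, ?_⟩
  rw [← act_smul, ← act_smul, ← act_add]
  rw [← act_act_inv M (Pz y), ← Pz_act]
  congr 1
  apply tri_ext <;> simp [vv]
  · exact hy
  · rw [hy] at h3; field_simp; linarith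

theorem contraction {M N : SL2} {g k : PSL2}
    (hid : ∀ ξ : OnePoint ℝ, ¬ (0 ≤ sd M (vv (bvec ξ)) ∧ 0 ≤ sd N (vv (bvec ξ))))
    (hdis : ∀ x : PSL2, ¬ (g⁻¹ * x ∈ CS M ∧ k⁻¹ * x ∈ CS N)) :
    ∃ δ : ℝ, 0 < δ ∧ ∀ y ∈ lineOf M, ∀ y' ∈ lineOf N, dist (g • y) (k • y') ≤ dist y y' - δ := by
  obtain ⟨G, rfl⟩ := QuotientGroup.mk_surjective g
  obtain ⟨K, rfl⟩ := QuotientGroup.mk_surjective k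
  have key : ∀ e f : Fin 2 → ℝ, (e = ![1, 0] ∨ e = ![0, 1]) → (f = ![1, 0] ∨ f = ![0, 1]) →
      Bf (act G (act M (vv e))) (act K (act N (vv f))) < Bf (act M (vv e)) (act N (vv f)) := by
    intro e f he hf
    have hne : ∀ (B : SL2) (e : Fin 2 → ℝ), (e = ![1, 0] ∨ e = ![0, 1]) → (B : Matrix (Fin 2) (Fin 2) ℝ).mulVec e ≠ 0 := by
      intro B e he h0
      have h1 : act B (vv e) = 0 := by rw [act_vv, h0]; simp [vv]
      refine act_ne_zero B ?_ h1
      apply vv_ne_zero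
      rcases he with rfl | rfl
      · intro h; have := congrFun h 0; simp at this
      · intro h; have := congrFun h 1; simp at this
    have hsd : ∀ (B : SL2) (e : Fin 2 → ℝ), (e = ![1, 0] ∨ e = ![0, 1]) → sd B (vv ((B : Matrix (Fin 2) (Fin 2) ℝ).mulVec e)) = 0 := by
      intro B e he
      rw [← act_vv, sd, act_inv_act]
      rcases he with rfl | rfl <;> simp [vv]
    rw [act_vv M, act_vv N]
    exact Bf_vv_lt hid (fun X => hdis (QuotientGroup.mk X)) (hne M e he) (hne N f hf) (hsd M e he) (hsd N f hf)
  have hnn : ∀ e f : Fin 2 → ℝ, 0 ≤ Bf (act G (act M (vv e))) (act K (act N (vv f))) := fun e f =>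
    (act_cone G (act_cone M (vv_cone e))).nonneg_Bf (act_cone K (act_cone N (vv_cone f)))
  have hκ : ∀ e f : Fin 2 → ℝ, (e = ![1, 0] ∨ e = ![0, 1]) → (f = ![1, 0] ∨ f = ![0, 1]) →
      ∃ κ : ℝ, κ < 1 ∧ Bf (act G (act M (vv e))) (act K (act N (vv f))) ≤ κ * Bf (act M (vv e)) (act N (vv f)) := by
    intro e f he hf
    have h1 := key e f he hf
    have h2 := hnn e f
    have h3 : 0 < Bf (act M (vv e)) (act N (vv f)) := by linarith
    exact ⟨_, (div_lt_one h3).2 h1, (div_mul_cancel₀ _ h3.ne').ge⟩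
  obtain ⟨κ1, a1, b1⟩ := hκ ![1, 0] ![1, 0] (Or.inl rfl) (Or.inl rfl)
  obtain ⟨κ2, a2, b2⟩ := hκ ![1, 0] ![0, 1] (Or.inl rfl) (Or.inr rfl)
  obtain ⟨κ3, a3, b3⟩ := hκ ![0, 1] ![1, 0] (Or.inr rfl) (Or.inl rfl)
  obtain ⟨κ4, a4, b4⟩ := hκ ![0, 1] ![0, 1] (Or.inr rfl) (Or.inr rfl)
  have hM : ∀ e f : Fin 2 → ℝ, 0 ≤ Bf (act M (vv e)) (act N (vv f)) := fun e f =>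
    (act_cone M (vv_cone e)).nonneg_Bf (act_cone N (vv_cone f))
  obtain ⟨κ, hκ0, hκ1, c1, c2, c3, c4⟩ : ∃ κ : ℝ, 0 < κ ∧ κ < 1 ∧ κ1 ≤ κ ∧ κ2 ≤ κ ∧ κ3 ≤ κ ∧ κ4 ≤ κ := by
    refine ⟨max (1 / 2) (max (max κ1 κ2) (max κ3 κ4)), ?_, ?_, ?_, ?_, ?_, ?_⟩
    · exact lt_of_lt_of_le (by norm_num) (le_max_left _ _)
    · simp only [max_lt_iff]; exact ⟨by norm_num, ⟨a1, a2⟩, a3, a4⟩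
    · simp
    · simp
    · simp
    · simp
  have d1 := b1.trans (mul_le_mul_of_nonneg_right c1 (hM _ _))
  have d2 := b2.trans (mul_le_mul_of_nonneg_right c2 (hM _ _))
  have d3 := b3.trans (mul_le_mul_of_nonneg_right c3 (hM _ _))
  have d4 := b4.trans (mul_le_mul_of_nonneg_right c4 (hM _ _))
  refine ⟨-Real.log κ, by have := Real.log_neg hκ0 hκ1; linarith, ?_⟩
  intro y hy y' hy'
  have hB : Bf (Pz ((QuotientGroup.mk G : PSL2) • y)) (Pz ((QuotientGroup.mk K : PSL2) • y')) ≤ κ * Bf (Pz y) (Pz y') := by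
    obtain ⟨t, ht, e1⟩ := line_param hy
    obtain ⟨u, hu, e2⟩ := line_param hy'
    have ht' : 0 < t⁻¹ := inv_pos.2 ht
    have hu' : 0 < u⁻¹ := inv_pos.2 hu
    rw [Pz_psl, Pz_psl, e1, e2]
    generalize t⁻¹ = t' at *
    generalize u⁻¹ = u' at *
    simp only [act_add, act_smul, Bf_add, Bf_add', Bf_smul, Bf_smul']
    have f1 := mul_le_mul_of_nonneg_left d1 (mul_pos hu ht).le
    have f2 := mul_le_mul_of_nonneg_left d2 (mul_pos hu' ht).le
    have f3 := mul_le_mul_of_nonneg_left d3 (mul_pos hu ht').le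
    have f4 := mul_le_mul_of_nonneg_left d4 (mul_pos hu' ht').le
    linarith
  rw [← cosh_Bf, ← cosh_Bf] at hB
  have hd : 0 < -Real.log κ := by have := Real.log_neg hκ0 hκ1; linarith
  have hexp : κ * Real.exp (-Real.log κ) = 1 := by
    rw [Real.exp_neg, Real.exp_log hκ0, mul_inv_cancel₀ hκ0.ne']
  generalize -Real.log κ = δ at *
  have hd' : 0 ≤ dist ((QuotientGroup.mk G : PSL2) • y) ((QuotientGroup.mk K : PSL2) • y') := dist_nonneg
  generalize dist ((QuotientGroup.mk G : PSL2) • y) ((QuotientGroup.mk K : PSL2) • y') = D at *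
  have h1 : Real.cosh (D + δ) ≤ Real.exp δ * Real.cosh D := by
    rw [Real.cosh_eq, Real.cosh_eq, neg_add, Real.exp_add, Real.exp_add]
    have : Real.exp (-δ) ≤ Real.exp δ := Real.exp_le_exp.2 (by linarith)
    have := mul_le_mul_of_nonneg_left this (Real.exp_pos (-D)).le
    linarith
  have h2 : Real.exp δ * Real.cosh D ≤ Real.cosh (dist y y') := by
    have := mul_le_mul_of_nonneg_left hB (Real.exp_pos δ).le
    have h3 : Real.exp δ * (κ * (2 * Real.cosh (dist y y'))) = 2 * Real.cosh (dist y y') := by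
      linear_combination (2 * Real.cosh (dist y y')) * hexp
    linarith
  have h3 := Real.cosh_le_cosh.1 (h1.trans h2)
  rw [abs_of_nonneg (by positivity), abs_of_nonneg dist_nonneg] at h3
  linarith


/-- Inverse letter. -/
def bar {r : ℕ} (a : Fin r × Bool) : Fin r × Bool := (a.1, !a.2)

theorem bar_bar {r : ℕ} (a : Fin r × Bool) : bar (bar a) = a := by simp [bar]

theorem bar_ne {r : ℕ} (a : Fin r × Bool) : bar a ≠ a := by
  intro h
  have := congrArg Prod.snd h
  simp [bar] at this

/-- The letter as an element of the free group. -/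
def lt {r : ℕ} (a : Fin r × Bool) : FreeGroup (Fin r) := FreeGroup.mk [a]

theorem lt_bar {r : ℕ} (a : Fin r × Bool) : lt (bar a) = (lt a)⁻¹ := by
  simp [lt, bar, FreeGroup.inv_mk, FreeGroup.invRev]

/-- The combinatorial data. -/
structure Sys {r : ℕ} (j ρ : FreeGroup (Fin r) →* PSL2) (M : Fin r × Bool → SL2)
    (G : Fin r × Bool → PSL2) (δ : ℝ) : Prop where
  flip : ∀ a, ∃ A : SL2, (QuotientGroup.mk A : PSL2) = j (lt a) ∧
    ∀ P, sd (M a) (act A P) = - sd (M (bar a)) P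
  hR : ∀ a, ρ (lt a) = G a * j (lt a) * (G (bar a))⁻¹
  nest : ∀ a b, a ≠ b → ∀ z, 0 ≤ sd (M a) (Pz z) → sd (M b) (Pz z) < 0
  pos : 0 < δ
  con : ∀ a b, a ≠ b → ∀ y ∈ lineOf (M a), ∀ y' ∈ lineOf (M b),
    dist (G a • y) (G b • y') ≤ dist y y' - δ
  dis : ∀ a b, a ≠ b → ∀ x : PSL2, ¬ ((G a)⁻¹ * x ∈ CS (M a) ∧ (G b)⁻¹ * x ∈ CS (M b))

/-- Reduced chains of letters. -/
inductive Ch {r : ℕ} : Fin r × Bool → ℕ → FreeGroup (Fin r) → Fin r × Bool → Prop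
  | base (b) : Ch b 0 1 b
  | step (a) {b1 n w b} : Ch b1 n w b → b1 ≠ bar a → Ch a (n + 1) (lt a * w) b

theorem Ch_snoc {r : ℕ} {a b : Fin r × Bool} {n w} (h : Ch a n w b) {c} (hc : c ≠ bar b) :
    Ch a (n + 1) (w * lt b) c := by
  induction h with
  | base b => simpa using Ch.step b (Ch.base c) hc
  | step a h1 h2 ih => rw [mul_assoc]; exact Ch.step a (ih hc) h2

theorem Ch_of_reduced {r : ℕ} (L : List (Fin r × Bool)) : ∀ a, FreeGroup.IsReduced (a :: L) →
    ∃ w b, Ch a L.length w b ∧ FreeGroup.mk (a :: L) = w * lt b := by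
  induction L with
  | nil => intro a _; exact ⟨1, a, Ch.base a, by simp [lt]⟩
  | cons c L ih =>
    intro a h
    have h' := h
    rw [FreeGroup.IsReduced, List.isChain_cons_cons] at h'
    obtain ⟨w, b, h1, h2⟩ := ih c h'.2
    refine ⟨lt a * w, b, Ch.step a h1 ?_, ?_⟩
    · rintro rfl
      have := h'.1 rfl
      simp [bar] at this
    · rw [mul_assoc, ← h2, lt, FreeGroup.mul_mk]; rfl

theorem Ch_of_ne_one {r : ℕ} {γ : FreeGroup (Fin r)} (h : γ ≠ 1) :
    ∃ a n w b, Ch a n w b ∧ γ = w * lt b ∧ γ.toWord.length = n + 1 := by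
  have hr := FreeGroup.isReduced_toWord (x := γ)
  have hm := FreeGroup.mk_toWord (x := γ)
  rcases hL : γ.toWord with _ | ⟨a, L⟩
  · exact absurd (FreeGroup.toWord_eq_nil_iff.1 hL) h
  · rw [hL] at hr hm
    obtain ⟨w, b, h1, h2⟩ := Ch_of_reduced L a hr
    exact ⟨a, _, w, b, h1, by rw [← h2, hm], rfl⟩

section core
variable {r : ℕ} {j ρ : FreeGroup (Fin r) →* PSL2} {M : Fin r × Bool → SL2}
    {G : Fin r × Bool → PSL2} {δ : ℝ}

theorem Sys.flip' (S : Sys j ρ M G δ) (a) (z : ℍ) :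
    sd (M a) (Pz (j (lt a) • z)) = - sd (M (bar a)) (Pz z) := by
  obtain ⟨A, hA, h⟩ := S.flip a
  rw [← hA, Pz_psl, h]

theorem Sys.nonneg (S : Sys j ρ M G δ) {a n w b} (h : Ch a n w b) {q : ℍ}
    (hq : 0 ≤ sd (M b) (Pz q)) : 0 ≤ sd (M a) (Pz (j w • q)) := by
  induction h with
  | base b => simpa using hq
  | step a h1 h2 ih =>
    have := S.nest _ _ h2 _ (ih hq)
    rw [map_mul, mul_smul, S.flip']; linarith

theorem Sys.posi (S : Sys j ρ M G δ) {a n w b} (h : Ch a n w b) {q : ℍ}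
    (hq : 0 < sd (M b) (Pz q)) : 0 < sd (M a) (Pz (j w • q)) := by
  cases h with
  | base b => simpa using hq
  | step a h1 h2 =>
    have := S.nest _ _ h2 _ (S.nonneg h1 hq.le)
    rw [map_mul, mul_smul, S.flip']; linarith

theorem Sys.back (S : Sys j ρ M G δ) {a n w b} (h : Ch a n w b) {p : ℍ}
    (hp : sd (M a) (Pz p) ≤ 0) : sd (M b) (Pz ((j w)⁻¹ • p)) ≤ 0 := by
  by_contra hc
  have := S.posi h (not_le.1 hc)
  rw [smul_inv_smul] at this
  linarith

theorem Sys.GJ (S : Sys j ρ M G δ) (a) (z : ℍ) :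
    G a • j (lt a) • z = ρ (lt a) • G (bar a) • z := by
  rw [S.hR, mul_smul, mul_smul, inv_smul_smul]

theorem Sys.chain (S : Sys j ρ M G δ) {a n w b} (h : Ch a n w b) {q : ℍ}
    (hq : q ∈ lineOf (M b)) : ∀ {p : ℍ}, sd (M a) (Pz p) ≤ 0 →
    dist (G a • p) (ρ w • G b • q) ≤ dist p (j w • q) - n * δ := by
  induction h with
  | base b => intro p _; simp [psl_dist]
  | @step a b1 n w b h1 h2 ih =>
    intro p hp
    have hq0 : sd (M b) (Pz q) = 0 := hq
    have e1 := S.nonneg h1 hq0.ge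
    have e2 := S.nest _ _ h2 _ e1
    have e3 : 0 ≤ sd (M a) (Pz (j (lt a) • j w • q)) := by rw [S.flip']; linarith
    obtain ⟨m, hm, hd⟩ := crossing hp e3
    obtain ⟨m', rfl⟩ : ∃ m', m = j (lt a) • m' := ⟨(j (lt a))⁻¹ • m, by rw [smul_inv_smul]⟩
    have hm0 : sd (M (bar a)) (Pz m') = 0 := by
      have : sd (M a) (Pz (j (lt a) • m')) = 0 := hm
      rw [S.flip'] at this; linarith
    have e4 := S.nest _ _ h2.symm m' hm0.ge
    obtain ⟨m2, hm2, hd2⟩ := crossing e4.le e1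
    have hm20 : sd (M b1) (Pz m2) = 0 := hm2
    have i1 := ih hq hm20.le
    have i2 := S.con _ _ h2.symm m' hm0 m2 hm2
    rw [map_mul, map_mul, mul_smul, mul_smul]
    have t1 := dist_triangle (G a • p) (G a • j (lt a) • m') (ρ (lt a) • ρ w • G b • q)
    have t2 := dist_triangle (G (bar a) • m') (G b1 • m2) (ρ w • G b • q)
    rw [psl_dist, S.GJ, psl_dist] at t1
    rw [psl_dist] at hd
    push_cast
    linarith

theorem Sys.base_pt (S : Sys j ρ M G δ) (a0 : Fin r × Bool) :
    ∃ p0 : ℍ, ∀ a, sd (M a) (Pz p0) ≤ 0 := by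
  obtain ⟨z, hz⟩ := posOf_nonempty (M a0)
  have hz : 0 < sd (M a0) (Pz z) := hz
  obtain ⟨y, hy⟩ := posOf_nonempty (M a0 * Sw)
  have hy : 0 < sd (M a0 * Sw) (Pz y) := hy
  rw [sd_Sw] at hy
  obtain ⟨p, hp, -⟩ := crossing (M := M a0) (p := y) (q := z) (by linarith) hz.le
  have hp0 : sd (M a0) (Pz p) = 0 := hp
  refine ⟨p, fun a => ?_⟩
  by_cases h : a0 = a
  · rw [← h, hp0]
  · exact (S.nest _ _ h p hp0.ge).le

theorem Sys.star (S : Sys j ρ M G δ) {p0 : ℍ} (hp0 : ∀ a, sd (M a) (Pz p0) ≤ 0) {a n w b}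
    (h : Ch a n w b) : dist p0 (ρ (w * lt b) • p0) ≤ dist p0 (j (w * lt b) • p0)
      + dist p0 (G a • p0) + dist p0 (G (bar b) • p0) - n * δ := by
  have e1 : 0 ≤ sd (M b) (Pz (j (lt b) • p0)) := by
    rw [S.flip']; linarith [hp0 (bar b)]
  have e2 := S.back h (hp0 a)
  obtain ⟨q, hq, hd⟩ := crossing e2 e1
  have h1 := S.chain h hq (hp0 a)
  have d1 : dist ((j w)⁻¹ • p0) q = dist p0 (j w • q) := by
    rw [← psl_dist (j w), smul_inv_smul]
  have d2 : dist ((j w)⁻¹ • p0) (j (lt b) • p0) = dist p0 (j (w * lt b) • p0) := by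
    rw [← psl_dist (j w), smul_inv_smul, map_mul, mul_smul]
  have d3 : dist (ρ w • G b • q) (ρ (w * lt b) • G (bar b) • p0) = dist q (j (lt b) • p0) := by
    rw [map_mul, mul_smul, ← S.GJ, psl_dist, psl_dist]
  have d4 : dist (ρ (w * lt b) • G (bar b) • p0) (ρ (w * lt b) • p0) = dist p0 (G (bar b) • p0) := by
    rw [psl_dist, dist_comm]
  have t1 := dist_triangle4 p0 (G a • p0) (ρ w • G b • q) (ρ (w * lt b) • p0)
  have t2 := dist_triangle (ρ w • G b • q) (ρ (w * lt b) • G (bar b) • p0) (ρ (w * lt b) • p0)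
  linarith

theorem exists_bd (f : Fin r × Bool → ℝ) : ∃ D : ℝ, 0 ≤ D ∧ ∀ a, f a ≤ D := by
  refine ⟨∑ a, |f a|, Finset.sum_nonneg fun _ _ => abs_nonneg _, fun a => ?_⟩
  exact (le_abs_self _).trans (Finset.single_le_sum (f := fun a => |f a|) (fun _ _ => abs_nonneg _) (Finset.mem_univ a))

theorem Sys.star' (S : Sys j ρ M G δ) {p0 : ℍ} (hp0 : ∀ a, sd (M a) (Pz p0) ≤ 0) :
    ∃ C : ℝ, 0 ≤ C ∧ ∀ γ : FreeGroup (Fin r),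
      dist p0 (ρ γ • p0) ≤ dist p0 (j γ • p0) + C - γ.toWord.length * δ := by
  obtain ⟨D, hD0, hD⟩ := exists_bd (fun a => dist p0 (G a • p0))
  refine ⟨D + D + δ, by linarith [S.pos], fun γ => ?_⟩
  by_cases h : γ = 1
  · subst h; simp; linarith [S.pos]
  · obtain ⟨a, n, w, b, h1, rfl, h3⟩ := Ch_of_ne_one h
    have h4 := S.star hp0 h1
    rw [h3]; push_cast
    have := hD a; have := hD (bar b)
    linarith

theorem len_bd (j : FreeGroup (Fin r) →* PSL2) (p0 : ℍ) {L : ℝ} (hL : ∀ a, dist p0 (j (lt a) • p0) ≤ L)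
    (γ : FreeGroup (Fin r)) : dist p0 (j γ • p0) ≤ γ.toWord.length * L := by
  have key : ∀ W : List (Fin r × Bool), dist p0 (j (FreeGroup.mk W) • p0) ≤ W.length * L := by
    intro W
    induction W with
    | nil => simp [← FreeGroup.one_eq_mk]
    | cons a W ih =>
      have : (FreeGroup.mk (a :: W) : FreeGroup (Fin r)) = lt a * FreeGroup.mk W := by
        rw [lt, FreeGroup.mul_mk]; rfl
      rw [this, map_mul, mul_smul]
      have t := dist_triangle p0 (j (lt a) • p0) (j (lt a) • j (FreeGroup.mk W) • p0)
      rw [psl_dist] at t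
      have := hL a
      push_cast [List.length_cons]
      linarith
  have := key γ.toWord
  rwa [FreeGroup.mk_toWord] at this

theorem tl_le (g : PSL2) (m : ℍ) : transLength g ≤ dist m (g • m) :=
  ciInf_le (f := fun p : ℍ => dist p (pslSMul g p)) ⟨0, by rintro _ ⟨p, rfl⟩; exact dist_nonneg⟩ m

theorem pow_mid (g : PSL2) (k : ℕ) : ∀ x : ℍ, ∃ m : ℍ, dist m (g • m) ≤ dist x (g ^ (2 ^ k) • x) / 2 ^ k := by
  induction k with
  | zero => intro x; exact ⟨x, by simp⟩
  | succ k ih =>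
    intro x
    obtain ⟨m, hm⟩ := midpoint_ineq (g ^ (2 ^ k)) x
    obtain ⟨m', hm'⟩ := ih m
    refine ⟨m', hm'.trans ?_⟩
    rw [← mul_smul, ← pow_add, ← two_mul, ← pow_succ'] at hm
    rw [pow_succ' (2 : ℝ), ← div_div]
    gcongr

theorem pow_dist (h : PSL2) (p : ℍ) (N : ℕ) : dist p (h ^ N • p) ≤ N * dist p (h • p) := by
  induction N with
  | zero => simp
  | succ N ih =>
    rw [pow_succ', mul_smul]
    have t := dist_triangle p (h • p) (h • h ^ N • p)
    rw [psl_dist] at t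
    push_cast; linarith

theorem pow_dist' (h : PSL2) (p0 p : ℍ) (N : ℕ) :
    dist p0 (h ^ N • p0) ≤ 2 * dist p0 p + N * dist p (h • p) := by
  have t := dist_triangle4 p0 p (h ^ N • p) (h ^ N • p0)
  rw [psl_dist, dist_comm p p0] at t
  have := pow_dist h p N
  linarith

theorem Sys.part1 (S : Sys j ρ M G δ) (a0 : Fin r × Bool) :
    ∃ c < 1, ∀ γ : FreeGroup (Fin r), transLength (ρ γ) ≤ c * transLength (j γ) := by
  obtain ⟨p0, hp0⟩ := S.base_pt a0
  obtain ⟨C, hC0, hC⟩ := S.star' hp0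
  obtain ⟨L, hL0, hL⟩ := exists_bd (fun a => dist p0 (j (lt a) • p0))
  have hδ := S.pos
  set c : ℝ := max 0 (1 - δ / (L + 1)) with hc
  have hc0 : 0 ≤ c := le_max_left _ _
  have hcl : 1 - δ / (L + 1) ≤ c := le_max_right _ _
  have hL1 : 0 < L + 1 := by linarith
  have hmain : ∀ γ, dist p0 (ρ γ • p0) ≤ c * dist p0 (j γ • p0) + C := by
    intro γ
    have h1 := hC γ
    have h2 := len_bd j p0 hL γ
    have hd0 : 0 ≤ dist p0 (j γ • p0) := dist_nonneg
    generalize dist p0 (j γ • p0) = d at *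
    have hn : (0 : ℝ) ≤ γ.toWord.length := Nat.cast_nonneg _
    generalize (γ.toWord.length : ℝ) = N at *
    have h3 : d / (L + 1) ≤ N := by
      rw [div_le_iff₀ hL1]; linarith
    have h4 := mul_le_mul_of_nonneg_right hcl hd0
    have h5 := mul_le_mul_of_nonneg_right h3 hδ.le
    have h6 : (1 - δ / (L + 1)) * d = d - d / (L + 1) * δ := by ring
    linarith
  refine ⟨c, max_lt one_pos (by have := div_pos hδ hL1; linarith), fun γ => ?_⟩
  have key : ∀ p : ℍ, transLength (ρ γ) ≤ c * dist p (j γ • p) := by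
    intro p
    by_contra hcon
    push Not at hcon
    obtain ⟨k, hk⟩ := pow_unbounded_of_one_lt ((c * (2 * dist p0 p) + C) / (transLength (ρ γ) - c * dist p (j γ • p))) (one_lt_two : (1 : ℝ) < 2)
    rw [div_lt_iff₀ (by linarith)] at hk
    obtain ⟨m, hm⟩ := pow_mid (ρ γ) k p0
    have h1 := (tl_le (ρ γ) m).trans hm
    rw [le_div_iff₀ (by positivity)] at h1
    have h2 := hmain (γ ^ 2 ^ k)
    rw [map_pow, map_pow] at h2
    have h3 := mul_le_mul_of_nonneg_left (pow_dist' (j γ) p0 p (2 ^ k)) hc0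
    push_cast at h3
    linarith
  rw [transLength.eq_1 (j γ), Real.mul_iInf_of_nonneg hc0]
  exact le_ciInf key

theorem bdd_of_compact (p0 : ℍ) {K : Set PSL2} (hK : IsCompact K) :
    ∃ B : ℝ, ∀ k ∈ K, dist p0 (k • p0) ≤ B := by
  have hcont : Continuous (fun k : PSL2 => 2 * Real.cosh (dist p0 (k • p0))) := by
    rw [(isQuotientMap_quotient_mk' : IsQuotientMap (QuotientGroup.mk : SL2 → PSL2)).continuous_iff]
    have : ((fun k : PSL2 => 2 * Real.cosh (dist p0 (k • p0))) ∘ (QuotientGroup.mk : SL2 → PSL2))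
        = fun A : SL2 => Bf (Pz p0) (act A (Pz p0)) := by
      funext A
      simp only [Function.comp]
      rw [cosh_Bf, Pz_psl]
    change Continuous ((fun k : PSL2 => 2 * Real.cosh (dist p0 (k • p0))) ∘ (QuotientGroup.mk : SL2 → PSL2))
    rw [this]
    have h1 : Continuous fun A : SL2 => act A (Pz p0) :=
      continuous_act_joint.comp (continuous_id.prodMk continuous_const)
    unfold Bf
    fun_prop
  obtain ⟨B, hB⟩ := hK.bddAbove_image hcont.continuousOn
  refine ⟨B, fun k hk => ?_⟩
  have h1 := hB ⟨k, hk, rfl⟩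
  have h2 := Real.add_one_le_exp (dist p0 (k • p0))
  have h3 := Real.cosh_eq (dist p0 (k • p0))
  have h4 := Real.exp_pos (-dist p0 (k • p0))
  simp only at h1
  linarith

theorem Sys.part2 (S : Sys j ρ M G δ) (a0 : Fin r × Bool) : ProperlyDisc j ρ := by
  obtain ⟨p0, hp0⟩ := S.base_pt a0
  obtain ⟨C, hC0, hC⟩ := S.star' hp0
  intro K hK
  obtain ⟨B, hB⟩ := bdd_of_compact p0 hK
  obtain ⟨N, hN⟩ := exists_nat_ge ((2 * B + C) / δ)
  have hfin : {W : List (Fin r × Bool) | W.length ≤ N}.Finite := List.finite_length_le _ _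
  refine (hfin.preimage (f := FreeGroup.toWord) (FreeGroup.toWord_injective.injOn)).subset ?_
  rintro γ ⟨y, ⟨x, hx, hxy⟩, hy⟩
  show γ.toWord.length ≤ N
  have h1 := hC γ
  have hbx := hB x hx
  have hby := hB y hy
  have e : y * j γ = ρ γ * x := by rw [← hxy]; group
  have e1 : dist p0 (j γ • p0) = dist (y • p0) (ρ γ • x • p0) := by
    rw [← psl_dist y, ← mul_smul, e, mul_smul]
  have t := dist_triangle4 (y • p0) p0 (ρ γ • p0) (ρ γ • x • p0)
  rw [psl_dist, dist_comm (y • p0) p0] at t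
  rw [div_le_iff₀ S.pos] at hN
  have h2 : (γ.toWord.length : ℝ) * δ ≤ N * δ := by linarith
  exact_mod_cast le_of_mul_le_mul_right h2 S.pos

theorem Sys.T1 (S : Sys j ρ M G δ) (a) {x : PSL2} (hx : (G (bar a))⁻¹ * x ∉ OS (M (bar a))) :
    (G a)⁻¹ * (ρ (lt a) * x * (j (lt a))⁻¹) ∈ CS (M a) := by
  have hx' : (G (bar a))⁻¹ * x ∈ CS (M (bar a) * Sw) := by rw [← compl_OS]; exact hx
  have e : (G a)⁻¹ * (ρ (lt a) * x * (j (lt a))⁻¹) = j (lt a) * ((G (bar a))⁻¹ * x) * (j (lt a))⁻¹ := by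
    rw [S.hR]; group
  rw [e]
  obtain ⟨A, hA, h⟩ := S.flip a
  obtain ⟨B, hB, P, hP, hs⟩ := hx'
  rw [← hA, ← hB]
  refine ⟨A * B * A⁻¹, rfl, act A P, Fx_conj A hP, ?_⟩
  rw [sd_Sw] at hs
  rwa [h]

theorem Sys.T2 (S : Sys j ρ M G δ) (a) {x : PSL2} (hx : (G (bar a))⁻¹ * x ∈ OS (M (bar a))) :
    (G a)⁻¹ * (ρ (lt a) * x * (j (lt a))⁻¹) ∉ OS (M a) := by
  intro hc
  have e : (G a)⁻¹ * (ρ (lt a) * x * (j (lt a))⁻¹) = j (lt a) * ((G (bar a))⁻¹ * x) * (j (lt a))⁻¹ := by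
    rw [S.hR]; group
  rw [e] at hc
  have hx' : (G (bar a))⁻¹ * x ∉ CS (M (bar a) * Sw) := by rw [← compl_OS]; exact fun h => h hx
  apply hx'
  obtain ⟨A, hA, h⟩ := S.flip a
  obtain ⟨B, hB, P, hP, hs⟩ := OS_subset_CS _ hc
  refine ⟨A⁻¹ * B * (A⁻¹)⁻¹, ?_, act A⁻¹ P, Fx_conj _ hP, ?_⟩
  · have : (QuotientGroup.mk (A⁻¹ * B * (A⁻¹)⁻¹) : PSL2)
      = (QuotientGroup.mk A : PSL2)⁻¹ * (QuotientGroup.mk B : PSL2) * ((QuotientGroup.mk A : PSL2)⁻¹)⁻¹ := rfl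
    rw [this, hA, hB]; group
  · rw [sd_Sw, ← h, act_act_inv]; exact hs

/-- Union of the open half-spaces. -/
def EE (M : Fin r × Bool → SL2) (G : Fin r × Bool → PSL2) : Set PSL2 :=
  {x | ∃ a, (G a)⁻¹ * x ∈ OS (M a)}

theorem EE_open (M : Fin r × Bool → SL2) (G : Fin r × Bool → PSL2) : IsOpen (EE M G) := by
  have : EE M G = ⋃ a, (fun x => (G a)⁻¹ * x) ⁻¹' OS (M a) := by
    ext x; simp [EE]
  rw [this]
  exact isOpen_iUnion fun a => (OS_open _).preimage (continuous_const_mul _)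

theorem Sys.infin (S : Sys j ρ M G δ) {x : PSL2}
    (hx : ∀ γ, (ρ γ)⁻¹ * x * j γ ∈ EE M G) (n : ℕ) :
    ∃ a w b, Ch a n w b ∧ (G b)⁻¹ * ((ρ w)⁻¹ * x * j w) ∈ OS (M b) := by
  induction n with
  | zero =>
    obtain ⟨b, hb⟩ := hx 1
    exact ⟨b, 1, b, Ch.base b, hb⟩
  | succ n ih =>
    obtain ⟨a, w, b, h, hb⟩ := ih
    obtain ⟨c, hc⟩ := hx (w * lt b)
    refine ⟨a, w * lt b, c, Ch_snoc h ?_, hc⟩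
    rintro rfl
    apply S.T2 b hc
    convert hb using 2
    rw [map_mul, map_mul]; group

theorem Sys.cover (S : Sys j ρ M G δ) (a0 : Fin r × Bool) (x : PSL2) :
    ∃ γ, (ρ γ)⁻¹ * x * j γ ∉ EE M G := by
  by_contra hcon
  push Not at hcon
  obtain ⟨p0, hp0⟩ := S.base_pt a0
  obtain ⟨D, hD0, hD⟩ := exists_bd (fun a => dist (x • p0) (G a • p0))
  obtain ⟨n, hn⟩ := exists_nat_gt (D / δ)
  rw [div_lt_iff₀ S.pos] at hn
  obtain ⟨a, w, b, h, hb⟩ := S.infin hcon n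
  have e2 := S.back h (hp0 a)
  obtain ⟨q, hq, hd⟩ := lemma_G hb e2
  have h1 := S.chain h hq (hp0 a)
  have d1 : dist ((j w)⁻¹ • p0) q = dist p0 (j w • q) := by
    rw [← psl_dist (j w), smul_inv_smul]
  have d2 : dist (((G b)⁻¹ * ((ρ w)⁻¹ * x * j w)) • (j w)⁻¹ • p0) q = dist (x • p0) (ρ w • G b • q) := by
    rw [← psl_dist (ρ w * G b), ← mul_smul, ← mul_smul, ← mul_smul]
    congr 2
    group
  have t := dist_triangle (x • p0) (G a • p0) (ρ w • G b • q)
  have := hD a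
  linarith

theorem Sys.absorb (S : Sys j ρ M G δ) {a n w b} (h : Ch a n w b) {y : PSL2}
    (hy : (G b)⁻¹ * y ∈ CS (M b)) : (G a)⁻¹ * (ρ w * y * (j w)⁻¹) ∈ CS (M a) := by
  induction h with
  | base b => simpa using hy
  | @step a b1 n w b h1 h2 ih =>
    have h3 := ih hy
    have h4 : (G (bar a))⁻¹ * (ρ w * y * (j w)⁻¹) ∉ OS (M (bar a)) := fun h5 =>
      S.dis _ _ h2 _ ⟨h3, OS_subset_CS _ h5⟩
    have h6 := S.T1 a h4
    convert h6 using 2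
    rw [map_mul, map_mul]; group

theorem Sys.part3 (S : Sys j ρ M G δ) (a0 : Fin r × Bool) : IsFundDom j ρ (EE M G)ᶜ := by
  refine ⟨(EE_open M G).isClosed_compl, ?_, ?_⟩
  · rw [Set.eq_univ_iff_forall]
    intro x
    obtain ⟨γ, hγ⟩ := S.cover a0 x
    exact Set.mem_iUnion.2 ⟨γ, _, hγ, by group⟩
  · intro γ₁ γ₂ hne
    rw [Set.disjoint_left]
    intro z hz1 hz2
    have hγ : γ₁⁻¹ * γ₂ ≠ 1 := by
      intro h; exact hne (inv_mul_eq_one.1 h)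
    obtain ⟨a, n, w, b, h1, h2, -⟩ := Ch_of_ne_one hγ
    -- the translated open set
    let f : PSL2 → PSL2 := fun x => (G a)⁻¹ * ((ρ γ₁)⁻¹ * x * j γ₁)
    let k : PSL2 → PSL2 := fun h => ρ γ₁ * (G a * h) * (j γ₁)⁻¹
    have hk : Continuous k := by fun_prop
    have hkf : ∀ x, k (f x) = x := fun x => by simp only [k, f]; group
    have hV : IsOpen (k ⁻¹' (interior (actImg j ρ γ₁ (EE M G)ᶜ) ∩ interior (actImg j ρ γ₂ (EE M G)ᶜ))) :=
      (isOpen_interior.inter isOpen_interior).preimage hk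
    have hmem : f z ∈ k ⁻¹' (interior (actImg j ρ γ₁ (EE M G)ᶜ) ∩ interior (actImg j ρ γ₂ (EE M G)ᶜ)) := by
      rw [Set.mem_preimage, hkf]; exact ⟨hz1, hz2⟩
    have hz : f z ∈ CS (M a) := by
      obtain ⟨x, hx, hxz⟩ := interior_subset hz2
      have hx' : (G (bar b))⁻¹ * x ∉ OS (M (bar b)) := fun hh => hx ⟨_, hh⟩
      have h3 := S.absorb h1 (S.T1 b hx')
      convert h3 using 1
      have e1 : γ₂ = γ₁ * (w * lt b) := by rw [← h2]; group
      simp only [f]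
      rw [← hxz, e1]
      simp only [map_mul]
      group
    obtain ⟨y, hy1, hy2⟩ := mem_closure_iff.1 (CS_subset_closure _ hz) _ hV hmem
    obtain ⟨x, hx, hxy⟩ := interior_subset hy1.1
    apply hx
    refine ⟨a, ?_⟩
    convert hy2 using 1
    have : G a * y = x := by
      simp only [k] at hxy
      exact mul_left_cancel (mul_right_cancel hxy.symm)
    rw [← this]; group
end core

theorem stmt11 (r : ℕ) (hr : 1 ≤ r)
    (l l' U U' : Fin r → Set ℍ)
    (hgeo : ∀ i, IsGeodesicLine (l i)) (hgeo' : ∀ i, IsGeodesicLine (l' i))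
    (hU : ∀ i, IsCC (l i)ᶜ (U i)) (hU' : ∀ i, IsCC (l' i)ᶜ (U' i))
    (hdisjhp : ∀ p q : Fin r × Bool, p ≠ q →
      Disjoint
        (closure (embH '' (if p.2 then l' p.1 ∪ U' p.1 else l p.1 ∪ U p.1)))
        (closure (embH '' (if q.2 then l' q.1 ∪ U' q.1 else l q.1 ∪ U q.1))))
    (j : FreeGroup (Fin r) →* PSL2)
    (hj : ∀ i, pslImg (j (FreeGroup.of i)) (l i ∪ U i) = (U' i)ᶜ)
    (g g' : Fin r → PSL2)
    (hhs : ∀ p q : Fin r × Bool, p ≠ q →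
      Disjoint
        (if p.2 then (g' p.1 * ·) '' closedRHS (l' p.1) (U' p.1)
          else (g p.1 * ·) '' closedRHS (l p.1) (U p.1))
        (if q.2 then (g' q.1 * ·) '' closedRHS (l' q.1) (U' q.1)
          else (g q.1 * ·) '' closedRHS (l q.1) (U q.1)))
    (ρ : FreeGroup (Fin r) →* PSL2)
    (hρ : ∀ i, ρ (FreeGroup.of i) = g' i * j (FreeGroup.of i) * (g i)⁻¹) :
    (∃ c < 1, ∀ γ : FreeGroup (Fin r), transLength (ρ γ) ≤ c * transLength (j γ)) ∧
    ProperlyDisc j ρ ∧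
    IsFundDom j ρ
      ((⋃ i, ((g i * ·) '' openRHS (l i) (U i)) ∪ ((g' i * ·) '' openRHS (l' i) (U' i)))ᶜ) := by
  have hs := fun i => exists_side (hgeo i) (hU i)
  choose M0 hl0 hU0 using hs
  have hs' := fun i => exists_side (hgeo' i) (hU' i)
  choose M1 hl1 hU1 using hs'
  have hA := fun i => QuotientGroup.mk_surjective (j (FreeGroup.of i))
  choose A hA using hA
  have hpos : ∀ i, posOf (M1 i) = posOf (A i * M0 i * Sw) := by
    intro i
    ext z
    have h1 : z ∈ U' i ↔ z ∉ pslImg (j (FreeGroup.of i)) (l i ∪ U i) := by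
      rw [hj i, Set.mem_compl_iff, not_not]
    rw [← hU1 i, h1, posOf, Set.mem_setOf_eq, sd_Sw, neg_pos, ← not_le]
    refine not_congr ?_
    have h2 : ∀ y, y ∈ l i ∪ U i ↔ 0 ≤ sd (M0 i) (Pz y) := by
      intro y
      rw [hl0 i, hU0 i, Set.mem_union, lineOf, posOf, Set.mem_setOf_eq, Set.mem_setOf_eq,
        le_iff_lt_or_eq, or_comm, eq_comm]
    constructor
    · rintro ⟨y, hy, rfl⟩
      rw [psl_smul_def, ← hA i, Pz_psl, sd_mul_act]
      exact (h2 y).1 hy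
    · intro h
      refine ⟨(j (FreeGroup.of i))⁻¹ • z, (h2 _).2 ?_, ?_⟩
      · rw [← sd_mul_act (A i), ← Pz_psl, hA i, smul_inv_smul]; exact h
      · rw [psl_smul_def, smul_inv_smul]
  let M : Fin r × Bool → SL2 := fun a => if a.2 then A a.1 * M0 a.1 * Sw else M0 a.1
  let G : Fin r × Bool → PSL2 := fun a => if a.2 then g' a.1 else g a.1
  have hMl : ∀ a : Fin r × Bool, (if a.2 then l' a.1 else l a.1) = lineOf (M a) := by
    rintro ⟨i, b⟩
    cases b
    · exact hl0 i
    · exact (hl1 i).trans (lineOf_eq_of_posOf_eq (hpos i))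
  have hMU : ∀ a : Fin r × Bool, (if a.2 then U' a.1 else U a.1) = posOf (M a) := by
    rintro ⟨i, b⟩
    cases b
    · exact hU0 i
    · exact (hU1 i).trans (hpos i)
  have hH : ∀ a : Fin r × Bool, (if a.2 then l' a.1 ∪ U' a.1 else l a.1 ∪ U a.1)
      = lineOf (M a) ∪ posOf (M a) := by
    intro a
    rw [← hMl a, ← hMU a]
    split_ifs <;> rfl
  have hC : ∀ a : Fin r × Bool, (if a.2 then (g' a.1 * ·) '' closedRHS (l' a.1) (U' a.1)
          else (g a.1 * ·) '' closedRHS (l a.1) (U a.1)) = (G a * ·) '' CS (M a) := by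
    intro a
    rw [← closedRHS_eq, ← hMl a, ← hMU a]
    simp only [G]
    split_ifs <;> rfl
  have hdis : ∀ a b, a ≠ b → ∀ x : PSL2, ¬ ((G a)⁻¹ * x ∈ CS (M a) ∧ (G b)⁻¹ * x ∈ CS (M b)) := by
    rintro a b hab x ⟨h1, h2⟩
    have h := hhs a b hab
    rw [hC a, hC b, Set.disjoint_left] at h
    exact h ⟨_, h1, mul_inv_cancel_left _ _⟩ ⟨_, h2, mul_inv_cancel_left _ _⟩
  have hnest : ∀ a b, a ≠ b → ∀ z, 0 ≤ sd (M a) (Pz z) → sd (M b) (Pz z) < 0 := by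
    intro a b hab z hz
    by_contra hc
    push Not at hc
    have hm : ∀ a, 0 ≤ sd (M a) (Pz z) → embH z ∈ closure (embH '' (lineOf (M a) ∪ posOf (M a))) := by
      intro a h
      refine subset_closure ⟨z, ?_, rfl⟩
      rcases h.eq_or_lt with h | h
      · exact Or.inl h.symm
      · exact Or.inr h
    have h := hdisjhp a b hab
    rw [hH a, hH b, Set.disjoint_left] at h
    exact h (hm a hz) (hm b hc)
  have hid : ∀ a b, a ≠ b → ∀ ξ : OnePoint ℝ,
      ¬ (0 ≤ sd (M a) (vv (bvec ξ)) ∧ 0 ≤ sd (M b) (vv (bvec ξ))) := by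
    rintro a b hab ξ ⟨h1, h2⟩
    have hm : ∀ a, 0 ≤ sd (M a) (vv (bvec ξ)) →
        toC ξ ∈ closure (embH '' (lineOf (M a) ∪ posOf (M a))) := by
      intro a h
      obtain ⟨u, hu, hlim⟩ := (isIdealPoint_iff (M a) ξ).2 h
      exact mem_closure_of_tendsto hlim (Eventually.of_forall fun n => ⟨u n, Or.inr (hu n), rfl⟩)
    have h := hdisjhp a b hab
    rw [hH a, hH b, Set.disjoint_left] at h
    exact h (hm a h1) (hm b h2)
  have hδ : ∃ δ : ℝ, 0 < δ ∧ ∀ a b, a ≠ b → ∀ y ∈ lineOf (M a), ∀ y' ∈ lineOf (M b),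
      dist (G a • y) (G b • y') ≤ dist y y' - δ := by
    have h1 : ∀ x : (Fin r × Bool) × (Fin r × Bool), ∃ δ : ℝ, 0 < δ ∧ (x.1 ≠ x.2 →
        ∀ y ∈ lineOf (M x.1), ∀ y' ∈ lineOf (M x.2),
        dist (G x.1 • y) (G x.2 • y') ≤ dist y y' - δ) := by
      intro x
      by_cases hx : x.1 = x.2
      · exact ⟨1, one_pos, fun h => absurd hx h⟩
      · obtain ⟨δ, h0, h⟩ := contraction (hid _ _ hx) (hdis _ _ hx)
        exact ⟨δ, h0, fun _ => h⟩
    choose f hf0 hf using h1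
    haveI : Nonempty (Fin r × Bool) := ⟨(⟨0, hr⟩, true)⟩
    obtain ⟨x, hx⟩ := Finite.exists_min f
    refine ⟨f x, hf0 x, fun a b hab y hy y' hy' => ?_⟩
    have := hf (a, b) hab y hy y' hy'
    have := hx (a, b)
    linarith
  obtain ⟨δ, hδ0, hδ⟩ := hδ
  have S : Sys j ρ M G δ := by
    refine ⟨?_, ?_, hnest, hδ0, hδ, hdis⟩
    · rintro ⟨i, b⟩
      cases b
      · refine ⟨(A i)⁻¹, ?_, fun P => ?_⟩
        · have e : lt (i, false) = (FreeGroup.of i)⁻¹ := lt_bar (i, true)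
          rw [e, map_inv, ← hA i]; rfl
        · show sd (M0 i) (act (A i)⁻¹ P) = - sd (A i * M0 i * Sw) P
          rw [sd_Sw, neg_neg, ← sd_mul_act (A i), act_act_inv]
      · refine ⟨A i, hA i, fun P => ?_⟩
        show sd (A i * M0 i * Sw) (act (A i) P) = - sd (M0 i) P
        rw [sd_Sw, sd_mul_act]
    · rintro ⟨i, b⟩
      cases b
      · have e : lt (i, false) = (FreeGroup.of i)⁻¹ := lt_bar (i, true)
        show ρ (lt (i, false)) = g i * j (lt (i, false)) * (g' i)⁻¹
        rw [e, map_inv, map_inv, hρ]; group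
      · exact hρ i
  have a0 : Fin r × Bool := (⟨0, hr⟩, true)
  have hEE : (⋃ i, ((g i * ·) '' openRHS (l i) (U i)) ∪ ((g' i * ·) '' openRHS (l' i) (U' i)))
      = EE M G := by
    have o0 : ∀ i, openRHS (l i) (U i) = OS (M (i, false)) := by
      intro i; rw [← openRHS_eq, ← hMl, ← hMU]; rfl
    have o1 : ∀ i, openRHS (l' i) (U' i) = OS (M (i, true)) := by
      intro i; rw [← openRHS_eq, ← hMl, ← hMU]; rfl
    ext x
    simp only [Set.mem_iUnion, Set.mem_union, o0, o1, EE, Set.mem_setOf_eq]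
    constructor
    · rintro ⟨i, ⟨y, hy, rfl⟩ | ⟨y, hy, rfl⟩⟩
      · refine ⟨(i, false), ?_⟩
        show (g i)⁻¹ * (g i * y) ∈ _
        rwa [inv_mul_cancel_left]
      · refine ⟨(i, true), ?_⟩
        show (g' i)⁻¹ * (g' i * y) ∈ _
        rwa [inv_mul_cancel_left]
    · rintro ⟨⟨i, b⟩, h⟩
      refine ⟨i, ?_⟩
      cases b
      · exact Or.inl ⟨_, h, mul_inv_cancel_left _ _⟩
      · exact Or.inr ⟨_, h, mul_inv_cancel_left _ _⟩
  rw [hEE]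
  exact ⟨S.part1 a0, S.part2 a0, S.part3 a0⟩

end
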